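/- arXiv:2505.07130 — 7 statements merged into one kernel-verified Lean document; each statement's English description precedes it below -/
import Mathlib

section
/- Let q be a prime power and let C ⊆ F_q^n be a linear [n,k]_q code with k ≥ 2 that satisfies the Ashikhmin-Barg condition, i.e. q·w_min(C) > (q−1)·w_max(C). Set n' = ⌈q·w_min(C)/(q−1)⌉ − w_max(C) (note that n' ≥ 1). Then there exists a linear [n+n', k]_q code C' ⊆ F_q^{n+n'} such that: C' is a minimal code, w_min(C') = w_min(C), w_max(C') ≥ w_max(C) + n', and q·w_min(C') ≤ (q−1)·w_max(C'). In particular, C' is a minimal linear code violating the Ashikhmin-Barg condition. -/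
open Finset BigOperators

/-- Ceiling division on naturals: `cdiv a b = ⌈a / b⌉`. -/
def cdiv (a b : ℕ) : ℕ := (a + b - 1) / b

/-- The minimum Hamming weight of a nonzero codeword of a linear code. -/
noncomputable def wmin {F : Type} [Field F] [Fintype F] [DecidableEq F] {n : ℕ}
    (C : Submodule F (Fin n → F)) : ℕ :=
  sInf {w | ∃ c ∈ C, c ≠ (0 : Fin n → F) ∧ hammingNorm c = w}

/-- The maximum Hamming weight of a codeword of a linear code. -/
noncomputable def wmax {F : Type} [Field F] [Fintype F] [DecidableEq F] {n : ℕ}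
    (C : Submodule F (Fin n → F)) : ℕ :=
  sSup {w | ∃ c ∈ C, hammingNorm c = w}

/-- A linear code is minimal if every nonzero codeword `c` is minimal: any codeword `c'`
whose support is contained in the support of `c` is a scalar multiple of `c`. -/
def IsMinimalCode {F : Type} [Field F] [Fintype F] [DecidableEq F] {n : ℕ}
    (C : Submodule F (Fin n → F)) : Prop :=
  ∀ c ∈ C, c ≠ (0 : Fin n → F) → ∀ c' ∈ C,
    {i : Fin n | c' i ≠ 0} ⊆ {i : Fin n | c i ≠ 0} → ∃ l : F, c' = l • c

/-- A linear code is self-orthogonal if the standard inner product of any two codewords is 0. -/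
def SelfOrthogonal {F : Type} [Field F] {n : ℕ} (C : Submodule F (Fin n → F)) : Prop :=
  ∀ c ∈ C, ∀ c' ∈ C, ∑ i, c i * c' i = 0

/-- A linear `[n,k]_q` code is projective if it is the image of `x ↦ (x·g_1, …, x·g_n)` for
nonzero, pairwise linearly independent vectors `g_1, …, g_n ∈ F_q^k`. -/
def IsProjectiveCode {F : Type} [Field F] {n : ℕ} (k : ℕ) (C : Submodule F (Fin n → F)) : Prop :=
  ∃ g : Fin n → (Fin k → F),
    (∀ i, g i ≠ 0) ∧
    (∀ i j, i ≠ j → ∀ l : F, g i ≠ l • g j) ∧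
    (C : Set (Fin n → F)) = {c | ∃ x : Fin k → F, c = fun i => ∑ t, x t * g i t}

/-- `Aw C w` is the number of codewords of `C` of Hamming weight `w`. -/
noncomputable def Aw {F : Type} [Field F] [Fintype F] [DecidableEq F] {n : ℕ}
    (C : Submodule F (Fin n → F)) (w : ℕ) : ℕ :=
  Set.ncard {c : Fin n → F | c ∈ C ∧ hammingNorm c = w}

theorem bddAbove_weights {F : Type} [Field F] [DecidableEq F] {n : ℕ}
    (C : Submodule F (Fin n → F)) :
    BddAbove {w | ∃ c ∈ C, hammingNorm c = w} :=
  ⟨n, by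
    rintro _ ⟨c, -, rfl⟩
    simpa using hammingNorm_le_card_fintype (x := c)⟩

section AppendFunctional

variable {F : Type} [Field F] {n : ℕ} {C : Submodule F (Fin n → F)}

/-- Extend each codeword `c` by `m` copies of the value `φ c`. -/
def appendFunctional (φ : C →ₗ[F] F) (m : ℕ) : C →ₗ[F] (Fin (n + m) → F) where
  toFun c := Fin.append (c : Fin n → F) fun _ => φ c
  map_add' x y := by
    ext i
    refine Fin.addCases (fun i => ?_) (fun i => ?_) i <;> simp
  map_smul' a x := by
    ext i
    refine Fin.addCases (fun i => ?_) (fun i => ?_) i <;> simp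

theorem appendFunctional_castAdd (φ : C →ₗ[F] F) (m : ℕ) (c : C) (i : Fin n) :
    appendFunctional φ m c (Fin.castAdd m i) = (c : Fin n → F) i :=
  Fin.append_left (c : Fin n → F) (fun _ : Fin m => φ c) i

theorem appendFunctional_natAdd (φ : C →ₗ[F] F) (m : ℕ) (c : C) (i : Fin m) :
    appendFunctional φ m c (Fin.natAdd n i) = φ c :=
  Fin.append_right (c : Fin n → F) (fun _ : Fin m => φ c) i

theorem appendFunctional_injective (φ : C →ₗ[F] F) (m : ℕ) :
    Function.Injective (appendFunctional φ m) := by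
  intro x y h
  ext i
  rw [← appendFunctional_castAdd φ m x, h, appendFunctional_castAdd]

theorem hammingNorm_appendFunctional [DecidableEq F] (φ : C →ₗ[F] F) (m : ℕ) (c : C) :
    hammingNorm (appendFunctional φ m c) =
      hammingNorm (c : Fin n → F) + if φ c ≠ 0 then m else 0 := by
  simp only [hammingNorm, card_filter, Fin.sum_univ_add, appendFunctional_castAdd,
    appendFunctional_natAdd]
  simp

end AppendFunctional

section LinearCode

variable {F : Type} [Field F] [Fintype F] [DecidableEq F] {n : ℕ} {C : Submodule F (Fin n → F)}

theorem wmin_le_hammingNorm {c : Fin n → F} (hc : c ∈ C) (h0 : c ≠ 0) :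
    wmin C ≤ hammingNorm c :=
  Nat.sInf_le ⟨c, hc, h0, rfl⟩

theorem exists_hammingNorm_eq_wmin (hC : C ≠ ⊥) :
    ∃ c ∈ C, c ≠ 0 ∧ hammingNorm c = wmin C := by
  obtain ⟨c, hc, h0⟩ := Submodule.exists_mem_ne_zero_of_ne_bot hC
  exact Nat.sInf_mem (s := {w | ∃ c ∈ C, c ≠ (0 : Fin n → F) ∧ hammingNorm c = w})
    ⟨_, c, hc, h0, rfl⟩

theorem hammingNorm_le_wmax {c : Fin n → F} (hc : c ∈ C) : hammingNorm c ≤ wmax C :=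
  le_csSup (bddAbove_weights C) ⟨c, hc, rfl⟩

theorem exists_hammingNorm_eq_wmax (C : Submodule F (Fin n → F)) :
    ∃ c ∈ C, hammingNorm c = wmax C :=
  Nat.sSup_mem (s := {w | ∃ c ∈ C, hammingNorm c = w}) ⟨_, 0, C.zero_mem, rfl⟩
    (bddAbove_weights C)

/-- Summing weights along a line `c' - a • c` when the support of `c'` lies in that of `c`. -/
theorem sum_hammingNorm_sub_smul {c c' : Fin n → F}
    (h : {i : Fin n | c' i ≠ 0} ⊆ {i : Fin n | c i ≠ 0}) :
    ∑ a : F, hammingNorm (c' - a • c) = (Fintype.card F - 1) * hammingNorm c := by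
  simp only [hammingNorm, card_filter]
  rw [Finset.sum_comm, Finset.mul_sum]
  refine Finset.sum_congr rfl fun i _ => ?_
  by_cases hi : c i = 0
  · have hi' : c' i = 0 := by
      by_contra h'
      exact h h' hi
    simp [hi, hi']
  · have key : ∀ a : F, (c' - a • c) i ≠ 0 ↔ a ≠ c' i / c i := by
      intro a
      rw [Pi.sub_apply, Pi.smul_apply, smul_eq_mul, Ne, sub_eq_zero, ne_eq, eq_div_iff hi,
        eq_comm]
    simp only [key]
    rw [← card_filter, Finset.filter_ne', Finset.card_erase_of_mem (Finset.mem_univ _)]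
    simp [hi]

/-- The Ashikhmin–Barg condition implies minimality. -/
theorem isMinimalCode_of_lt
    (hAB : (Fintype.card F - 1) * wmax C < Fintype.card F * wmin C) : IsMinimalCode C := by
  intro c hc _ c' hc' hsub
  by_contra! hne
  refine hAB.not_ge ?_
  calc Fintype.card F * wmin C = ∑ _a : F, wmin C := by simp
    _ ≤ ∑ a : F, hammingNorm (c' - a • c) := Finset.sum_le_sum fun a _ =>
        wmin_le_hammingNorm (C.sub_mem hc' (C.smul_mem a hc)) (sub_ne_zero.2 (hne a))
    _ = (Fintype.card F - 1) * hammingNorm c := sum_hammingNorm_sub_smul hsub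
    _ ≤ _ := Nat.mul_le_mul_left _ (hammingNorm_le_wmax hc)

theorem exists_wmin_wmax_notMem_span (hk : 2 ≤ Module.finrank F C) :
    ∃ u v : C, (u : Fin n → F) ≠ 0 ∧ hammingNorm (u : Fin n → F) = wmin C ∧
      hammingNorm (v : Fin n → F) = wmax C ∧ v ∉ Submodule.span F {u} := by
  have hC : C ≠ ⊥ := by
    rintro rfl
    simp at hk
  obtain ⟨u, hu, hu0, huw⟩ := exists_hammingNorm_eq_wmin hC
  obtain ⟨v, hv, hvw⟩ := exists_hammingNorm_eq_wmax C
  by_cases hmem : (⟨v, hv⟩ : C) ∈ Submodule.span F {(⟨u, hu⟩ : C)}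
  · obtain ⟨a, ha⟩ := Submodule.mem_span_singleton.1 hmem
    have hav : a • u = v := congrArg Subtype.val ha
    have hle : wmax C ≤ wmin C := by
      rw [← hvw, ← huw, ← hav]
      exact hammingNorm_smul_le_hammingNorm
    have hlt : Submodule.span F {(⟨u, hu⟩ : C)} ≠ ⊤ := by
      intro htop
      have := finrank_span_le_card (R := F) ({(⟨u, hu⟩ : C)} : Set C)
      rw [htop, finrank_top] at this
      simp at this
      omega
    obtain ⟨w, -, hw⟩ := SetLike.exists_of_lt (lt_top_iff_ne_top.2 hlt)
    have hw0 : (w : Fin n → F) ≠ 0 := by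
      intro h
      exact hw (by rw [show w = 0 from Subtype.ext h]; exact Submodule.zero_mem _)
    exact ⟨⟨u, hu⟩, w, hu0, huw, le_antisymm (hammingNorm_le_wmax w.2)
      (hle.trans (wmin_le_hammingNorm w.2 hw0)), hw⟩
  · exact ⟨⟨u, hu⟩, ⟨v, hv⟩, hu0, huw, hvw, hmem⟩

theorem IsMinimalCode.range_appendFunctional (hC : IsMinimalCode C) (φ : C →ₗ[F] F) (m : ℕ) :
    IsMinimalCode (LinearMap.range (appendFunctional φ m)) := by
  rintro _ ⟨x, rfl⟩ hx _ ⟨y, rfl⟩ hsub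
  have hx0 : (x : Fin n → F) ≠ 0 := by
    intro h
    exact hx (by rw [show x = 0 from Subtype.ext h, map_zero])
  obtain ⟨a, ha⟩ := hC x x.2 hx0 y y.2 fun i hi => by
    have := @hsub (Fin.castAdd m i)
    simp only [Set.mem_ofPred_eq, appendFunctional_castAdd] at this
    exact this hi
  exact ⟨a, by rw [← map_smul, show y = a • x from Subtype.ext ha]⟩

end LinearCode

theorem le_mul_cdiv (a : ℕ) {b : ℕ} (hb : 0 < b) : a ≤ b * cdiv a b := by
  have h := Nat.div_add_mod (a + b - 1) b
  have h' := Nat.mod_lt (a + b - 1) hb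
  unfold cdiv
  omega

/-- Theorem 1.1 / 2.1. From a minimal code satisfying the Ashikhmin-Barg
condition, one constructs a minimal code of length `n + n'` violating it. -/
theorem minimal_code_violating_AB_from_AB
    {F : Type} [Field F] [Fintype F] [DecidableEq F] {n k : ℕ}
    (C : Submodule F (Fin n → F)) (hdim : Module.finrank F C = k) (hk : 2 ≤ k)
    (hAB : Fintype.card F * wmin C > (Fintype.card F - 1) * wmax C)
    (n' : ℕ) (hn' : n' = cdiv (Fintype.card F * wmin C) (Fintype.card F - 1) - wmax C) :
    ∃ C' : Submodule F (Fin (n + n') → F),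
      Module.finrank F C' = k ∧
      IsMinimalCode C' ∧
      wmin C' = wmin C ∧
      wmax C' ≥ wmax C + n' ∧
      Fintype.card F * wmin C' ≤ (Fintype.card F - 1) * wmax C' := by
  subst hdim
  obtain ⟨u, v, hu0, hu, hv, huv⟩ := exists_wmin_wmax_notMem_span hk
  obtain ⟨φ, hφv, hφ⟩ := Submodule.exists_le_ker_of_notMem huv
  have hφu : φ u = 0 := hφ (Submodule.mem_span_singleton_self u)
  have hmax : wmax C + n' ≤ wmax (LinearMap.range (appendFunctional φ n')) := by
    have h := hammingNorm_le_wmax (LinearMap.mem_range_self (appendFunctional φ n') v)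
    rwa [hammingNorm_appendFunctional, hv, if_pos hφv] at h
  have hmin : wmin (LinearMap.range (appendFunctional φ n')) = wmin C := by
    apply le_antisymm
    · have hne : appendFunctional φ n' u ≠ 0 := by
        intro h
        rw [← map_zero (appendFunctional φ n')] at h
        exact hu0 (congrArg Subtype.val (appendFunctional_injective φ n' h))
      have h := wmin_le_hammingNorm (LinearMap.mem_range_self (appendFunctional φ n') u) hne
      simpa [hammingNorm_appendFunctional, hφu, hu] using h
    · refine le_csInf ⟨_, _, LinearMap.mem_range_self (appendFunctional φ n') v, ?_, rfl⟩ ?_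
      · intro h
        rw [← map_zero (appendFunctional φ n')] at h
        exact hφv (by rw [appendFunctional_injective φ n' h, map_zero])
      · rintro _ ⟨_, ⟨x, rfl⟩, hx, rfl⟩
        have hx0 : (x : Fin n → F) ≠ 0 := by
          intro h
          exact hx (by rw [show x = 0 from Subtype.ext h, map_zero])
        rw [hammingNorm_appendFunctional]
        exact (wmin_le_hammingNorm x.2 hx0).trans (Nat.le_add_right _ _)
  refine ⟨LinearMap.range (appendFunctional φ n'),
    LinearMap.finrank_range_of_inj (appendFunctional_injective φ n'),
    (isMinimalCode_of_lt hAB).range_appendFunctional φ n', hmin, hmax, ?_⟩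
  rw [hmin]
  have hq : 0 < Fintype.card F - 1 := Nat.sub_pos_of_lt Fintype.one_lt_card
  exact (le_mul_cdiv _ hq).trans (Nat.mul_le_mul_left _ (by omega))
end

section
/- Let q be a prime power, let C ⊆ F_q^n be a projective linear [n,k]_q code with k ≥ 1 and n ≥ 1, and let w = w_max(C) be its maximum weight (so w ≤ n). Let h ≥ 1 be an integer. Then there exists a linear code with parameters [(q^{k+h}−1)/(q−1) − n, k+h, q^{k+h−1} − w]_q (length (q^{k+h}−1)/(q−1) − n, dimension k+h, minimum weight exactly q^{k+h−1} − w) whose maximum weight equals q^{k+h−1}. Moreover, if q^{k+h−2} > w (equivalently, h > log_q(w) − k + 2), then this code is a minimal code satisfying the Ashikhmin-Barg condition, i.e. q·(q^{k+h−1} − w) > (q−1)·q^{k+h−1}. -/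
open Finset BigOperators

open scoped LinearAlgebra.Projectivization

/-- **Ashikhmin–Barg**: a code whose minimum and maximum weights are close enough is minimal. -/
theorem isMinimalCode_of_ashikhmin_barg {F : Type} [Field F] [Fintype F] [DecidableEq F] {n : ℕ}
    (C : Submodule F (Fin n → F)) {a b : ℕ}
    (ha : ∀ c ∈ C, c ≠ 0 → a ≤ hammingNorm c) (hb : ∀ c ∈ C, hammingNorm c ≤ b)
    (hab : (Fintype.card F - 1) * b < Fintype.card F * a) : IsMinimalCode C := by
  intro c hc _ c' hc' hsupp
  by_contra! hne
  have hsum : ∑ l : F, hammingNorm (c' - l • c) = (Fintype.card F - 1) * hammingNorm c := by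
    simp only [hammingNorm, Finset.card_filter]
    rw [Finset.sum_comm, Finset.mul_sum]
    refine Finset.sum_congr rfl fun i _ => ?_
    by_cases hi : c i = 0
    · have hi' : c' i = 0 := by
        by_contra h0
        exact hsupp h0 hi
      simp [hi, hi']
    · have hiff : ∀ l : F, (c' - l • c) i ≠ 0 ↔ l ≠ c' i / c i := by
        intro l
        rw [Pi.sub_apply, Pi.smul_apply, smul_eq_mul, Ne, Ne, sub_eq_zero, eq_div_iff hi,
          eq_comm]
      simp only [hiff, ← Finset.card_filter]
      simp [hi, Finset.filter_ne', Finset.card_erase_of_mem]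
  have hlow : Fintype.card F * a ≤ ∑ l : F, hammingNorm (c' - l • c) := by
    simpa using Finset.card_nsmul_le_sum Finset.univ
      (fun l : F => hammingNorm (c' - l • c)) a fun l _ =>
        ha _ (C.sub_mem hc' (C.smul_mem l hc)) (sub_ne_zero.mpr (hne l))
  have hup := Nat.mul_le_mul_left (Fintype.card F - 1) (hb c hc)
  omega

section Points

variable {F E : Type} [Field F] [Fintype F] [AddCommGroup E] [Module F E] [Finite E]

/-- Points off the hyperplane `f = 0` correspond to the vectors of the affine hyperplane
`f = 1`. -/
theorem Projectivization.natCard_apply_rep_ne_zero (f : Module.Dual F E) (hf : f ≠ 0) :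
    Nat.card {p : ℙ F E // f p.rep ≠ 0} =
      Fintype.card F ^ (Module.finrank F E - 1) := by
  obtain ⟨v₀, hv₀⟩ := f.surjective hf 1
  have e₁ : LinearMap.ker f ≃ {p : ℙ F E // f p.rep ≠ 0} := by
    refine Equiv.ofBijective (fun u => ⟨.mk F (u.1 + v₀) ?_, ?_⟩) ⟨?_, ?_⟩
    · intro h0
      have := congrArg f h0
      simp [hv₀] at this
    · obtain ⟨a, ha⟩ := Projectivization.exists_smul_eq_mk_rep F (u.1 + v₀) (by
        intro h0
        have := congrArg f h0
        simp [hv₀] at this)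
      rw [← ha]
      simp [hv₀, Units.smul_def]
    · rintro ⟨u, hu⟩ ⟨u', hu'⟩ heq
      rw [LinearMap.mem_ker] at hu hu'
      simp only [Subtype.mk.injEq, Projectivization.mk_eq_mk_iff'] at heq
      obtain ⟨a, ha⟩ := heq
      have hfa := congrArg f ha
      simp only [map_smul, map_add, hu, hu', hv₀, zero_add, smul_eq_mul, mul_one] at hfa
      subst hfa
      simpa using ha.symm
    · rintro ⟨p, hp⟩
      refine ⟨⟨(f p.rep)⁻¹ • p.rep - v₀, by simp [hv₀, hp]⟩, ?_⟩
      rw [Subtype.mk.injEq]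
      conv_rhs => rw [← p.mk_rep]
      rw [Projectivization.mk_eq_mk_iff']
      exact ⟨(f p.rep)⁻¹, by simp⟩
  have hker := Module.Dual.finrank_ker_add_one_of_ne_zero hf
  rw [← Nat.card_congr e₁, Module.natCard_eq_pow_finrank (K := F), Nat.card_eq_fintype_card]
  congr 1
  omega

/-- Representatives of the projective points missed by a family of distinct points: the two
families together form a simplex code, all of whose nonzero weights are `q ^ (m - 1)`. -/
theorem exists_simplex_complement {m n : ℕ} (hm : Module.finrank F E = m) (v : Fin n → E)
    (hv : ∀ i, v i ≠ 0) (hindep : ∀ i j, i ≠ j → ∀ l : F, v i ≠ l • v j) [DecidableEq F] :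
    ∃ u : Fin ((Fintype.card F ^ m - 1) / (Fintype.card F - 1) - n) → E,
      ∀ f : Module.Dual F E, f ≠ 0 →
        hammingNorm (fun j => f (u j)) + hammingNorm (fun i => f (v i)) =
          Fintype.card F ^ (m - 1) := by
  classical
  have := Fintype.ofFinite (ℙ F E)
  let P : Fin n ↪ ℙ F E := ⟨fun i => .mk F (v i) (hv i), fun i j hij => by
    obtain ⟨l, hl⟩ := (Projectivization.mk_eq_mk_iff' F _ _ _ _).mp hij
    by_contra hne
    exact hindep i j hne l hl.symm⟩
  let S : Finset (ℙ F E) := Finset.univ.map P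
  have hcard : Fintype.card ↥Sᶜ = (Fintype.card F ^ m - 1) / (Fintype.card F - 1) - n := by
    rw [Fintype.card_coe, Finset.card_compl, Finset.card_map, Finset.card_univ, Fintype.card_fin,
      ← Nat.card_eq_fintype_card, Projectivization.card'',
      Module.natCard_eq_pow_finrank (K := F), hm, Nat.card_eq_fintype_card]
  let e := (Fintype.equivFinOfCardEq hcard).symm
  refine ⟨fun j => (e j).1.rep, fun f hf => ?_⟩
  have hrep : ∀ i, f (P i).rep ≠ 0 ↔ f (v i) ≠ 0 := by
    intro i
    obtain ⟨a, ha⟩ := Projectivization.exists_smul_eq_mk_rep F (v i) (hv i)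
    have : (P i).rep = a • v i := ha.symm
    simp [this, Units.smul_def]
  have hS : hammingNorm (fun i => f (v i)) = ∑ p ∈ S, if f p.rep ≠ 0 then 1 else 0 := by
    simp only [S, Finset.sum_map, hrep, hammingNorm, Finset.card_filter]
  have hSc : hammingNorm (fun j => f (e j).1.rep) = ∑ p ∈ Sᶜ, if f p.rep ≠ 0 then 1 else 0 := by
    rw [hammingNorm, Finset.card_filter,
      Equiv.sum_comp e (fun p : ↥Sᶜ => if f p.1.rep ≠ 0 then 1 else 0),
      Finset.sum_coe_sort Sᶜ (fun p => if f p.rep ≠ 0 then 1 else 0)]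
  rw [hS, hSc, Finset.sum_compl_add_sum, ← Finset.card_filter, ← hm,
    ← Projectivization.natCard_apply_rep_ne_zero f hf, Nat.card_eq_fintype_card,
    Fintype.card_subtype]

end Points

section Weights

variable {F : Type} [Field F] [Fintype F] [DecidableEq F] {n : ℕ}

theorem wmin_eq_of_isLeast {C : Submodule F (Fin n → F)} {a : ℕ}
    (hle : ∀ c ∈ C, c ≠ 0 → a ≤ hammingNorm c)
    (hex : ∃ c ∈ C, c ≠ 0 ∧ hammingNorm c = a) : wmin C = a :=
  IsLeast.csInf_eq ⟨hex, by rintro _ ⟨c, hc, h0, rfl⟩; exact hle c hc h0⟩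

theorem wmax_eq_of_isGreatest {C : Submodule F (Fin n → F)} {b : ℕ}
    (hle : ∀ c ∈ C, hammingNorm c ≤ b) (hex : ∃ c ∈ C, hammingNorm c = b) : wmax C = b :=
  IsGreatest.csSup_eq ⟨hex, by rintro _ ⟨c, hc, rfl⟩; exact hle c hc⟩

theorem isGreatest_wmax (C : Submodule F (Fin n → F)) :
    IsGreatest {w | ∃ c ∈ C, hammingNorm c = w} (wmax C) := by
  have hbdd : BddAbove {w | ∃ c ∈ C, hammingNorm c = w} :=
    ⟨n, by rintro _ ⟨c, -, rfl⟩; simpa using hammingNorm_le_card_fintype (x := c)⟩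
  exact ⟨Nat.sSup_mem ⟨_, 0, C.zero_mem, rfl⟩ hbdd, fun _ hb => le_csSup hbdd hb⟩

end Weights

/-- Theorem 1.2 / 3.1. The simplex complementary code of an arbitrary projective
linear code, and its minimality under the Ashikhmin-Barg condition. -/
theorem simplex_complementary_code_of_projective
    {F : Type} [Field F] [Fintype F] [DecidableEq F] {n k : ℕ}
    (hk : 1 ≤ k) (hn : 1 ≤ n)
    (C : Submodule F (Fin n → F)) (hdim : Module.finrank F C = k)
    (hproj : IsProjectiveCode k C)
    (w : ℕ) (hw : w = wmax C) (hwn : w ≤ n)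
    (h : ℕ) (hh : 1 ≤ h) :
    ∃ D : Submodule F
        (Fin ((Fintype.card F ^ (k + h) - 1) / (Fintype.card F - 1) - n) → F),
      Module.finrank F D = k + h ∧
      wmin D = Fintype.card F ^ (k + h - 1) - w ∧
      wmax D = Fintype.card F ^ (k + h - 1) ∧
      (Fintype.card F ^ (k + h - 2) > w →
        IsMinimalCode D ∧
        Fintype.card F * (Fintype.card F ^ (k + h - 1) - w) >
          (Fintype.card F - 1) * Fintype.card F ^ (k + h - 1)) := by
  obtain ⟨g, hg0, hgi, hC⟩ := hproj
  set q := Fintype.card F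
  have hq1 : 1 < q := Fintype.one_lt_card
  have hmem : ∀ c, c ∈ C ↔ ∃ φ : Module.Dual F (Fin k → F), c = fun i => φ (g i) := by
    intro c
    rw [← SetLike.mem_coe, hC, (dotProductEquiv F (Fin k)).surjective.exists]
    rfl
  have hwC : IsGreatest {w | ∃ c ∈ C, hammingNorm c = w} w := hw ▸ isGreatest_wmax C
  obtain ⟨φ, hφ0, hφ⟩ :
      ∃ φ : Module.Dual F (Fin k → F), φ ≠ 0 ∧ hammingNorm (fun i => φ (g i)) = w := by
    obtain ⟨c, hc, hcw⟩ := hwC.1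
    obtain ⟨φ, rfl⟩ := (hmem c).mp hc
    by_cases hφ : φ = 0
    · have hw0 : w = 0 := by simpa [hφ, hammingNorm] using hcw.symm
      refine ⟨LinearMap.proj ⟨0, hk⟩, fun h0 => ?_, ?_⟩
      · simpa using LinearMap.congr_fun h0 (fun _ => 1)
      · exact le_antisymm (hwC.2 ⟨_, (hmem _).mpr ⟨_, rfl⟩, rfl⟩) (hw0.trans_le (Nat.zero_le _))
    · exact ⟨φ, hφ, hcw⟩
  have hwlt : w < q ^ (k + h - 1) := by
    obtain ⟨u, hu⟩ := exists_simplex_complement (Module.finrank_fin_fun F) g hg0 hgi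
    have h1 : _ + _ = q ^ (k - 1) := hu φ hφ0
    have h2 : q ^ (k - 1) < q ^ (k + h - 1) := Nat.pow_lt_pow_right hq1 (by omega)
    omega
  obtain ⟨u, hu⟩ := exists_simplex_complement (F := F) (E := (Fin k → F) × (Fin h → F))
    (m := k + h) (by simp) (fun i => (g i, 0)) (by simpa using hg0)
    (fun i j hij l heq => hgi i j hij l (by simpa using congrArg Prod.fst heq))
  let Φ : Module.Dual F ((Fin k → F) × (Fin h → F)) →ₗ[F] (Fin _ → F) :=
    LinearMap.pi fun j => Module.Dual.eval F _ (u j)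
  have hΦ : ∀ f, f ≠ 0 →
      hammingNorm (Φ f) + hammingNorm (fun i => f (g i, 0)) = q ^ (k + h - 1) := hu
  have hle : ∀ f : Module.Dual F ((Fin k → F) × (Fin h → F)),
      hammingNorm (fun i => f (g i, 0)) ≤ w := fun f =>
    hwC.2 ⟨_, (hmem _).mpr ⟨f ∘ₗ LinearMap.inl F _ _, rfl⟩, rfl⟩
  have hne : ∀ f, f ≠ 0 → Φ f ≠ 0 := by
    intro f hf h0
    have h1 := hΦ f hf
    have h2 := hle f
    rw [h0, hammingNorm_zero] at h1
    omega
  have hlow : ∀ c ∈ LinearMap.range Φ, c ≠ 0 → q ^ (k + h - 1) - w ≤ hammingNorm c := by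
    rintro _ ⟨f, rfl⟩ h0
    have h1 := hΦ f fun hf => h0 (by rw [hf, map_zero])
    have h2 := hle f
    omega
  have hup : ∀ c ∈ LinearMap.range Φ, hammingNorm c ≤ q ^ (k + h - 1) := by
    rintro _ ⟨f, rfl⟩
    by_cases hf : f = 0
    · simp [hf]
    · have h1 := hΦ f hf
      omega
  refine ⟨LinearMap.range Φ, ?_, wmin_eq_of_isLeast hlow ?_, wmax_eq_of_isGreatest hup ?_,
    fun hlt => ?_⟩
  · rw [LinearMap.finrank_range_of_inj, Subspace.dual_finrank_eq]
    · simp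
    · rw [injective_iff_map_eq_zero]
      intro f hf
      by_contra h0
      exact hne f h0 hf
  · have hf : φ ∘ₗ LinearMap.fst F (Fin k → F) (Fin h → F) ≠ 0 := fun h0 =>
      hφ0 (LinearMap.ext fun x => LinearMap.congr_fun h0 (x, 0))
    have h1 := hΦ _ hf
    have h2 : hammingNorm (fun i =>
        (φ ∘ₗ LinearMap.fst F (Fin k → F) (Fin h → F)) (g i, 0)) = w := hφ
    exact ⟨_, ⟨_, rfl⟩, hne _ hf, by omega⟩
  · let f : Module.Dual F ((Fin k → F) × (Fin h → F)) :=
      LinearMap.proj ⟨0, hh⟩ ∘ₗ LinearMap.snd F _ _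
    have hf : f ≠ 0 := fun h0 => by
      simpa [f] using LinearMap.congr_fun h0 (0, fun _ => 1)
    have h1 := hΦ f hf
    have h2 : hammingNorm (fun i => f (g i, 0)) = 0 := by simp [f, hammingNorm]
    exact ⟨_, ⟨f, rfl⟩, by omega⟩
  · have hAB : (q - 1) * q ^ (k + h - 1) < q * (q ^ (k + h - 1) - w) := by
      have hpow : q ^ (k + h - 1) = q * q ^ (k + h - 2) := by
        rw [← pow_succ']
        congr 1
        omega
      have hqw : q * w < q ^ (k + h - 1) := hpow ▸ Nat.mul_lt_mul_of_pos_left hlt (by omega)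
      have hle' : q ^ (k + h - 1) ≤ q * q ^ (k + h - 1) := Nat.le_mul_of_pos_left _ (by omega)
      rw [Nat.sub_mul, Nat.mul_sub, one_mul]
      omega
    exact ⟨isMinimalCode_of_ashikhmin_barg _ hlow hup hAB, hAB⟩
end

section
/- Let k and t be positive integers and let u_1, ..., u_t be integers with k−1 > u_t > u_{t−1} > ... > u_1 ≥ 1 and u_1 + u_2 + ... + u_t < k. Then: (i) there exists a binary linear code (q = 2) with parameters [2^k − 1 − Σ_{i=1}^t (2^{u_i} − 1), k, 2^{k−1} − Σ_{i=1}^t 2^{u_i − 1}]_2 and maximum weight 2^{k−1} that is a minimal code satisfying the Ashikhmin-Barg condition; and (ii) there exists a binary linear code with parameters [2^k + 2^{k−1} + t − 1 − Σ_{i=1}^t 2^{u_i + 1}, k, 2^{k−1} − Σ_{i=1}^t 2^{u_i − 1}]_2 that is a minimal code violating the Ashikhmin-Barg condition. -/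
open Finset BigOperators

namespace SolomonStiffler

/-- The indicator that the parity check `∑ j ∈ v, x j` does not vanish. -/
def parity {κ : Type*} (x : κ → ZMod 2) (v : Finset κ) : ℕ :=
  if ∑ j ∈ v, x j ≠ 0 then 1 else 0

@[simp] lemma parity_empty {κ : Type*} (x : κ → ZMod 2) : parity x ∅ = 0 := by
  simp [parity]

lemma parity_singleton {κ : Type*} (x : κ → ZMod 2) (j : κ) :
    parity x {j} = if x j ≠ 0 then 1 else 0 := by
  simp [parity]

lemma sum_parity_powerset_of_forall_eq_zero {κ : Type*} (x : κ → ZMod 2)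
    (B : Finset κ) (h : ∀ j ∈ B, x j = 0) : ∑ v ∈ B.powerset, parity x v = 0 := by
  refine sum_eq_zero fun v hv => ?_
  have hv' : ∑ j ∈ v, x j = 0 := sum_eq_zero fun j hj => h j (mem_powerset.1 hv hj)
  simp [parity, hv']

lemma sum_parity_powerset_of_ne_zero {κ : Type*} [DecidableEq κ] (x : κ → ZMod 2)
    (B : Finset κ) {j : κ} (hj : j ∈ B) (hx : x j ≠ 0) :
    ∑ v ∈ B.powerset, parity x v = 2 ^ (#B - 1) := by
  have hflip : ∀ a b : ZMod 2, a ≠ 0 →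
      (if b ≠ 0 then 1 else 0) + (if a + b ≠ 0 then 1 else 0) = 1 := by decide
  rw [← insert_erase hj, sum_powerset_insert (notMem_erase j B), ← sum_add_distrib,
    insert_erase hj, ← card_erase_of_mem hj, ← card_powerset, card_eq_sum_ones]
  refine sum_congr rfl fun v hv => ?_
  have hjv : j ∉ v := fun h => notMem_erase j B (mem_powerset.1 hv h)
  simp only [parity, sum_insert hjv]
  exact hflip _ _ hx

lemma sum_parity_powerset_le {κ : Type*} [DecidableEq κ] (x : κ → ZMod 2) (B : Finset κ) :
    ∑ v ∈ B.powerset, parity x v ≤ 2 ^ (#B - 1) := by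
  by_cases h : ∃ j ∈ B, x j ≠ 0
  · obtain ⟨j, hj, hx⟩ := h
    exact (sum_parity_powerset_of_ne_zero x B hj hx).le
  · push Not at h
    rw [sum_parity_powerset_of_forall_eq_zero x B h]
    exact Nat.zero_le _

/-- The nonempty finsets contained in none of the blocks `B i`. Under the identification of
finsets with binary vectors these are the nonzero vectors outside the coordinate subspaces
spanned by the blocks. -/
def outside {κ τ : Type*} [Fintype κ] [DecidableEq κ] [Fintype τ] (B : τ → Finset κ) :
    Finset (Finset κ) :=
  univ.filter fun v => v ≠ ∅ ∧ ∀ i, ¬ v ⊆ B i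

section Weights

variable {κ τ : Type*} [Fintype κ] [DecidableEq κ] [Fintype τ]
  {B : τ → Finset κ}

lemma sum_outside_add (hB : Pairwise fun i j => Disjoint (B i) (B j)) (f : Finset κ → ℕ) :
    ∑ v ∈ outside B, f v + ∑ i, ∑ v ∈ (B i).powerset.erase ∅, f v
      = ∑ v ∈ univ.erase ∅, f v := by
  rw [← sum_biUnion, ← sum_union]
  · congr 1
    ext v
    simp only [outside, mem_union, mem_filter, mem_univ, true_and, mem_biUnion, mem_erase,
      mem_powerset, and_true]
    by_cases h : ∃ i, v ⊆ B i
    · have := h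
      push Not at *
      grind
    · grind
  · rw [Finset.disjoint_left]
    intro v hv hv'
    simp only [outside, mem_filter, mem_univ, true_and, mem_biUnion, mem_erase,
      mem_powerset] at hv hv'
    obtain ⟨i, -, hi⟩ := hv'
    exact hv.2 i hi
  · intro i _ j _ hij
    rw [Function.onFun, Finset.disjoint_left]
    intro v hv hv'
    simp only [mem_erase, mem_powerset] at hv hv'
    exact hv.1 (subset_empty.1 ((hB hij) hv.2 hv'.2))

lemma card_outside_add (hB : Pairwise fun i j => Disjoint (B i) (B j)) :
    #(outside B) + ∑ i, (2 ^ #(B i) - 1) = 2 ^ Fintype.card κ - 1 := by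
  have h := sum_outside_add hB fun _ => 1
  simpa [card_erase_of_mem] using h

lemma sum_parity_outside_add (hB : Pairwise fun i j => Disjoint (B i) (B j))
    {x : κ → ZMod 2} (hx : x ≠ 0) :
    ∑ v ∈ outside B, parity x v + ∑ i, ∑ v ∈ (B i).powerset, parity x v
      = 2 ^ (Fintype.card κ - 1) := by
  obtain ⟨j, hj⟩ := Function.ne_iff.1 hx
  have h := sum_outside_add hB (parity x)
  simp only [sum_erase _ (parity_empty x)] at h
  rw [h, ← card_univ, ← sum_parity_powerset_of_ne_zero x univ (mem_univ j) hj, powerset_univ]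

lemma sum_parity_outside_le (hB : Pairwise fun i j => Disjoint (B i) (B j))
    {x : κ → ZMod 2} (hx : x ≠ 0) :
    ∑ v ∈ outside B, parity x v ≤ 2 ^ (Fintype.card κ - 1) :=
  (Nat.le_add_right _ _).trans (sum_parity_outside_add hB hx).le

lemma le_sum_parity_outside (hB : Pairwise fun i j => Disjoint (B i) (B j))
    {x : κ → ZMod 2} (hx : x ≠ 0) :
    2 ^ (Fintype.card κ - 1) - ∑ i, 2 ^ (#(B i) - 1) ≤ ∑ v ∈ outside B, parity x v := by
  have h := sum_parity_outside_add hB hx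
  have h' : ∑ i, ∑ v ∈ (B i).powerset, parity x v ≤ ∑ i, 2 ^ (#(B i) - 1) :=
    sum_le_sum fun i _ => sum_parity_powerset_le x (B i)
  omega

end Weights

/-- The encoder whose coordinate functionals are the parities over the finsets `h a`. -/
def encoder {κ : Type*} {n : ℕ} (h : Fin n → Finset κ) :
    (κ → ZMod 2) →ₗ[ZMod 2] (Fin n → ZMod 2) :=
  LinearMap.pi fun a => ∑ j ∈ h a, LinearMap.proj j

lemma encoder_apply {κ : Type*} {n : ℕ} (h : Fin n → Finset κ) (x : κ → ZMod 2) (a : Fin n) :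
    encoder h x a = ∑ j ∈ h a, x j := by
  simp [encoder]

lemma hammingNorm_encoder {κ : Type*} {n : ℕ} (h : Fin n → Finset κ) (x : κ → ZMod 2) :
    hammingNorm (encoder h x) = ∑ a, parity x (h a) := by
  simp only [hammingNorm, encoder_apply, parity, card_filter]

/-- All elements of `D` together with `m` further copies of a finset `w` can be enumerated. -/
lemma exists_enumeration {κ : Type*} (D : Finset (Finset κ)) (w : Finset κ) {n m : ℕ}
    (hn : n = #D + m) :
    ∃ h : Fin n → Finset κ, (∀ v ∈ D, ∃ a, h a = v) ∧
      ∀ f : Finset κ → ℕ, ∑ a, f (h a) = ∑ v ∈ D, f v + m * f w := by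
  have e : Fin n ≃ D ⊕ Fin m := Fintype.equivOfCardEq (by simp [hn])
  refine ⟨fun a => Sum.elim Subtype.val (fun _ => w) (e a), fun v hv => ?_, fun f => ?_⟩
  · exact ⟨e.symm (Sum.inl ⟨v, hv⟩), by simp⟩
  · rw [e.sum_comp fun s => f (Sum.elim Subtype.val (fun _ => w) s), Fintype.sum_sum_type]
    simp only [Sum.elim_inl, Sum.elim_inr]
    rw [sum_coe_sort D f]
    simp

lemma wmin_eq {n w : ℕ} {C : Submodule (ZMod 2) (Fin n → ZMod 2)}
    (hle : ∀ c ∈ C, c ≠ 0 → w ≤ hammingNorm c) (hex : ∃ c ∈ C, c ≠ 0 ∧ hammingNorm c = w) :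
    wmin C = w :=
  IsLeast.csInf_eq ⟨hex, fun _ ⟨c, hc, hc0, h⟩ => h ▸ hle c hc hc0⟩

lemma le_wmax {n : ℕ} {C : Submodule (ZMod 2) (Fin n → ZMod 2)} {c : Fin n → ZMod 2}
    (hc : c ∈ C) : hammingNorm c ≤ wmax C :=
  le_csSup ⟨n, fun _ ⟨c, _, h⟩ => h ▸ by simpa using hammingNorm_le_card_fintype (x := c)⟩
    ⟨c, hc, rfl⟩

lemma wmax_le {n w : ℕ} {C : Submodule (ZMod 2) (Fin n → ZMod 2)}
    (h : ∀ c ∈ C, hammingNorm c ≤ w) : wmax C ≤ w :=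
  csSup_le ⟨_, 0, C.zero_mem, rfl⟩ fun _ ⟨c, hc, hw⟩ => hw ▸ h c hc

/-- The Solomon–Stiffler code of a family of disjoint blocks, with one coordinate outside the
blocks repeated `m` further times. -/
lemma exists_code {κ τ : Type*} [Fintype κ] [DecidableEq κ] [Fintype τ]
    {B : τ → Finset κ} (hB : Pairwise fun i j => Disjoint (B i) (B j))
    (hne : ∀ i, (B i).Nonempty) {j₀ : κ} (hj₀ : ∀ i, j₀ ∉ B i) [Nonempty τ]
    (hlt : 2 ^ (Fintype.card κ - 1) < 2 * (2 ^ (Fintype.card κ - 1) - ∑ i, 2 ^ (#(B i) - 1)))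
    {n m : ℕ} (hn : n + ∑ i, (2 ^ #(B i) - 1) = 2 ^ Fintype.card κ - 1 + m) :
    ∃ C : Submodule (ZMod 2) (Fin n → ZMod 2),
      Module.finrank (ZMod 2) C = Fintype.card κ ∧
      wmin C = 2 ^ (Fintype.card κ - 1) - ∑ i, 2 ^ (#(B i) - 1) ∧
      IsMinimalCode C ∧
      2 ^ (Fintype.card κ - 1) + m ≤ wmax C ∧
      wmax C ≤ 2 ^ (Fintype.card κ - 1) + m := by
  obtain ⟨h, hmem, hsum⟩ := exists_enumeration (outside B) {j₀} (n := n) (m := m)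
    (by have := card_outside_add hB; omega)
  have hwt (x : κ → ZMod 2) : hammingNorm (encoder h x)
      = ∑ v ∈ outside B, parity x v + m * if x j₀ ≠ 0 then 1 else 0 := by
    rw [hammingNorm_encoder, hsum, parity_singleton]
  have hle {x : κ → ZMod 2} (hx : x ≠ 0) := le_sum_parity_outside hB hx
  have hinj : Function.Injective (encoder h) := by
    rw [← LinearMap.ker_eq_bot, LinearMap.ker_eq_bot']
    intro x hx
    by_contra hx0
    have h0 := hwt x
    rw [hx, hammingNorm_zero] at h0
    have := hle hx0
    have := Nat.two_pow_pos (Fintype.card κ - 1)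
    omega
  refine ⟨LinearMap.range (encoder h), ?_, ?_, ?_, ?_, ?_⟩
  · rw [LinearMap.finrank_range_of_inj hinj, Module.finrank_pi]
  · refine wmin_eq ?_ ?_
    · rintro _ ⟨x, rfl⟩ hx
      have hx0 : x ≠ 0 := by rintro rfl; simp at hx
      have := hle hx0
      rw [hwt]
      omega
    · let x : κ → ZMod 2 := fun j => if j = j₀ then 0 else 1
      have hxB (i : τ) : ∑ v ∈ (B i).powerset, parity x v = 2 ^ (#(B i) - 1) := by
        obtain ⟨j, hj⟩ := hne i
        have : j ≠ j₀ := by rintro rfl; exact hj₀ i hj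
        exact sum_parity_powerset_of_ne_zero x (B i) hj (by simp [x, this])
      have hx : x ≠ 0 := by
        rintro hx
        obtain ⟨j, hj⟩ := hne (Classical.arbitrary τ)
        have : j ≠ j₀ := by rintro rfl; exact hj₀ _ hj
        simpa [x, this] using congrFun hx j
      refine ⟨_, ⟨x, rfl⟩, (map_ne_zero_iff _ hinj).2 hx, ?_⟩
      have := sum_parity_outside_add hB hx
      simp only [hxB] at this
      have hxj : x j₀ = 0 := by simp [x]
      rw [hwt, hxj]
      simp only [ne_eq, not_true_eq_false, if_false, mul_zero]
      omega
  · rintro _ ⟨x, rfl⟩ hx _ ⟨y, rfl⟩ hsub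
    have hx0 : x ≠ 0 := by rintro rfl; simp at hx
    by_cases hy0 : y = 0
    · exact ⟨0, by simp [hy0]⟩
    by_cases hxy : x = y
    · exact ⟨1, by simp [hxy]⟩
    exfalso
    have hdecomp : ∀ a b : ZMod 2, (b ≠ 0 → a ≠ 0) →
        (if a ≠ 0 then 1 else 0) = (if b ≠ 0 then 1 else 0) + (if a - b ≠ 0 then 1 else 0) := by
      decide
    have hadd : ∑ v ∈ outside B, parity x v
        = ∑ v ∈ outside B, parity y v + ∑ v ∈ outside B, parity (x - y) v := by
      rw [← sum_add_distrib]
      refine sum_congr rfl fun v hv => ?_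
      obtain ⟨a, rfl⟩ := hmem v hv
      have ha := @hsub a
      simp only [Set.mem_ofPred_eq, encoder_apply] at ha
      simp only [parity, Pi.sub_apply, sum_sub_distrib]
      exact hdecomp _ _ ha
    have h1 := hle hy0
    have h2 := hle (sub_ne_zero.2 hxy)
    have h3 := sum_parity_outside_le hB hx0
    omega
  · let x : κ → ZMod 2 := Pi.single j₀ 1
    have hx : x ≠ 0 := by simp [x]
    have hxB (i : τ) : ∑ v ∈ (B i).powerset, parity x v = 0 := by
      refine sum_parity_powerset_of_forall_eq_zero x (B i) fun j hj => ?_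
      have : j ≠ j₀ := by rintro rfl; exact hj₀ i hj
      simp [x, this]
    have hadd := sum_parity_outside_add hB hx
    simp only [hxB, sum_const_zero, add_zero] at hadd
    refine le_trans (le_of_eq ?_) (le_wmax (C := LinearMap.range (encoder h)) ⟨x, rfl⟩)
    rw [hwt, hadd]
    simp [x]
  · refine wmax_le ?_
    rintro _ ⟨x, rfl⟩
    by_cases hx : x = 0
    · simp [hx]
    · have := sum_parity_outside_le hB hx
      rw [hwt]
      split_ifs <;> omega

/-- Disjoint blocks of prescribed sizes, leaving at least one point uncovered. -/
lemma exists_blocks {τ : Type*} [Fintype τ] (u : τ → ℕ) {k : ℕ}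
    (h : ∑ i, u i < k) :
    ∃ (B : τ → Finset (Fin k)) (j₀ : Fin k), (Pairwise fun i j => Disjoint (B i) (B j)) ∧
      (∀ i, #(B i) = u i) ∧ ∀ i, j₀ ∉ B i := by
  obtain ⟨f⟩ : Nonempty (Option (Σ i, Fin (u i)) ↪ Fin k) :=
    Function.Embedding.nonempty_of_card_le (by simpa using h)
  refine ⟨fun i => univ.image fun a : Fin (u i) => f (some ⟨i, a⟩), f none, ?_, ?_, ?_⟩
  · intro i j hij
    simp only [Finset.disjoint_left, mem_image, mem_univ, true_and]
    rintro _ ⟨a, rfl⟩ ⟨b, hb⟩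
    have := congrArg Sigma.fst (Option.some_injective _ (f.injective hb))
    exact hij this.symm
  · intro i
    rw [card_image_of_injective _ fun a b hab => by simpa using hab]
    simp
  · simp

lemma sum_two_pow_lt {τ : Type*} [Fintype τ] {u : τ → ℕ} (hu : Function.Injective u) {n : ℕ}
    (h : ∀ i, u i < n) : ∑ i, 2 ^ u i < 2 ^ n := by
  classical
  rw [← sum_image (s := univ) (g := u) (f := fun j => 2 ^ j) fun i _ j _ hij => hu hij]
  exact Nat.geomSum_lt le_rfl (by simpa using h)

end SolomonStiffler

/-- Proposition 4.1. Binary Solomon–Stiffler codes are minimal codes satisfying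
the Ashikhmin-Barg condition, and they transform into minimal codes violating it. -/
theorem solomon_stiffler_minimal_codes
    {k t : ℕ} (hk : 1 ≤ k) (ht : 1 ≤ t) (u : Fin t → ℕ)
    (hmono : StrictMono u) (h1 : ∀ i, 1 ≤ u i) (hlt : ∀ i, u i + 1 < k)
    (hsum : ∑ i, u i < k) :
    (∃ C : Submodule (ZMod 2) (Fin (2 ^ k - 1 - ∑ i, (2 ^ u i - 1)) → ZMod 2),
        Module.finrank (ZMod 2) C = k ∧
        wmin C = 2 ^ (k - 1) - ∑ i, 2 ^ (u i - 1) ∧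
        wmax C = 2 ^ (k - 1) ∧
        IsMinimalCode C ∧
        2 * wmin C > (2 - 1) * wmax C) ∧
    (∃ C' : Submodule (ZMod 2)
        (Fin (2 ^ k + 2 ^ (k - 1) + t - 1 - ∑ i, 2 ^ (u i + 1)) → ZMod 2),
        Module.finrank (ZMod 2) C' = k ∧
        wmin C' = 2 ^ (k - 1) - ∑ i, 2 ^ (u i - 1) ∧
        IsMinimalCode C' ∧
        2 * wmin C' ≤ (2 - 1) * wmax C') := by
  obtain ⟨B, j₀, hB, hcard, hj₀⟩ := SolomonStiffler.exists_blocks u hsum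
  have hne (i : Fin t) : (B i).Nonempty := card_pos.1 (by rw [hcard]; exact h1 i)
  have : Nonempty (Fin t) := ⟨⟨0, ht⟩⟩
  have hpow : ∑ i, 2 ^ u i < 2 ^ (k - 1) :=
    SolomonStiffler.sum_two_pow_lt hmono.injective fun i => by have := hlt i; omega
  have hdouble : ∑ i, 2 ^ u i = 2 * ∑ i, 2 ^ (u i - 1) := by
    rw [mul_sum]
    refine sum_congr rfl fun i _ => ?_
    rw [← pow_succ', Nat.sub_add_cancel (h1 i)]
  have hdouble' : ∑ i, 2 ^ (u i + 1) = 2 * ∑ i, 2 ^ u i := by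
    simp only [pow_succ', mul_sum]
  have hkpow : 2 ^ k = 2 * 2 ^ (k - 1) := by
    rw [← pow_succ', Nat.sub_add_cancel hk]
  have hsub : ∑ i, (2 ^ u i - 1) + t = ∑ i, 2 ^ u i := by
    have : ∑ i, 2 ^ u i = ∑ i, (2 ^ u i - 1 + 1) :=
      sum_congr rfl fun i _ => (Nat.sub_add_cancel Nat.one_le_two_pow).symm
    simp [this, sum_add_distrib]
  have key := @SolomonStiffler.exists_code _ _ _ _ _ B hB hne j₀ hj₀ _
  simp only [hcard, Fintype.card_fin] at key
  have key := @key (by omega)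
  constructor
  · obtain ⟨C, hC, hmin, hm, hge, hle⟩ :=
      @key (2 ^ k - 1 - ∑ i, (2 ^ u i - 1)) 0 (by omega)
    exact ⟨C, hC, hmin, by omega, hm, by omega⟩
  · obtain ⟨C, hC, hmin, hm, hge, -⟩ :=
      @key (2 ^ k + 2 ^ (k - 1) + t - 1 - ∑ i, 2 ^ (u i + 1)) (2 ^ (k - 1) - ∑ i, 2 ^ u i)
        (by omega)
    exact ⟨C, hC, hmin, hm, by omega⟩
end

section
/- Let m ≥ 2 be an integer and set n' = 2^{2m−1} − 2^m − 2^{m−1}. Then there exists a binary linear code (q = 2) with parameters [2^{2m} − 1 + n', 3m, 2^{2m−1} − 2^{m−1}]_2 and maximum weight 2^{2m} − 2^m that is a minimal code violating the Ashikhmin-Barg condition. -/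
open Finset BigOperators

/-- A translate of a nonzero linear functional over `ZMod 2` is balanced. -/
theorem two_mul_hammingNorm_functional {V : Type*} [AddCommGroup V] [Module (ZMod 2) V] [Fintype V]
    (ψ : V →ₗ[ZMod 2] ZMod 2) (hψ : ψ ≠ 0) (ε : ZMod 2) :
    2 * hammingNorm (fun y => ψ y + ε) = Fintype.card V := by
  classical
  obtain ⟨y₀, hy₀⟩ : ∃ y, ψ y ≠ 0 := by
    by_contra! h
    exact hψ (LinearMap.ext h)
  have h_flip : ∀ s t : ZMod 2, t ≠ 0 → (s + t + ε ≠ 0 ↔ ¬ s + ε ≠ 0) := by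
    revert ε
    decide
  have h_card : #{y | ψ y + ε ≠ 0} = #{y | ¬ ψ y + ε ≠ 0} := by
    refine card_equiv (Equiv.addRight (-y₀)) fun y => ?_
    have := h_flip (ψ (y - y₀)) (ψ y₀) hy₀
    rw [← map_add, sub_add_cancel] at this
    simpa [sub_eq_add_neg] using this
  have h_total := card_filter_add_card_filter_not (s := univ) fun y : V => ψ y + ε ≠ 0
  rw [card_univ] at h_total
  change 2 * #{y | ψ y + ε ≠ 0} = _
  omega

section BentCode

variable {F : Type*} [Field F] [Algebra (ZMod 2) F] (φ : F →ₗ[ZMod 2] ZMod 2)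

/-- The quadratic function `(x, y) ↦ φ (b x y + a x + c y)` attached to `(a, c, b)`. -/
def bentWord : F × F × F →ₗ[ZMod 2] (F × F → ZMod 2) :=
  LinearMap.pi fun p => φ ∘ₗ
    (LinearMap.mulRight (ZMod 2) (p.1 * p.2) ∘ₗ LinearMap.snd (ZMod 2) F F ∘ₗ
        LinearMap.snd (ZMod 2) F (F × F) +
      LinearMap.mulRight (ZMod 2) p.1 ∘ₗ LinearMap.fst (ZMod 2) F (F × F) +
      LinearMap.mulRight (ZMod 2) p.2 ∘ₗ LinearMap.fst (ZMod 2) F F ∘ₗ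
        LinearMap.snd (ZMod 2) F (F × F))

theorem bentWord_apply (a c b x y : F) :
    bentWord φ (a, c, b) (x, y) = φ (b * (x * y) + a * x + c * y) := rfl

theorem bentWord_apply_zero (u : F × F × F) : bentWord φ u 0 = 0 := by
  have h := bentWord_apply φ u.1 u.2.1 u.2.2 0 0
  rwa [mul_zero, mul_zero, mul_zero, mul_zero, add_zero, add_zero, map_zero] at h

variable {φ}

theorem comp_mulLeft_ne_zero (hφ : φ ≠ 0) {t : F} (ht : t ≠ 0) :
    φ ∘ₗ LinearMap.mulLeft (ZMod 2) t ≠ 0 := by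
  contrapose! hφ
  ext z
  have := LinearMap.congr_fun hφ (t⁻¹ * z)
  simpa [mul_inv_cancel_left₀ ht] using this

variable [Fintype F]

theorem two_mul_hammingNorm_bentWord_linear (hφ : φ ≠ 0) {a c : F} (h : a ≠ 0 ∨ c ≠ 0) :
    2 * hammingNorm (bentWord φ (a, c, 0)) = Fintype.card F * Fintype.card F := by
  have hψ : (φ ∘ₗ LinearMap.mulLeft (ZMod 2) a).coprod
      (φ ∘ₗ LinearMap.mulLeft (ZMod 2) c) ≠ 0 := by
    intro h_zero
    obtain ha | hc := h
    · refine comp_mulLeft_ne_zero hφ ha ?_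
      rw [← LinearMap.coprod_inl (φ ∘ₗ LinearMap.mulLeft (ZMod 2) a)
        (φ ∘ₗ LinearMap.mulLeft (ZMod 2) c), h_zero, LinearMap.zero_comp]
    · refine comp_mulLeft_ne_zero hφ hc ?_
      rw [← LinearMap.coprod_inr (φ ∘ₗ LinearMap.mulLeft (ZMod 2) a)
        (φ ∘ₗ LinearMap.mulLeft (ZMod 2) c), h_zero, LinearMap.zero_comp]
  rw [← Fintype.card_prod, ← two_mul_hammingNorm_functional _ hψ 0]
  congr 2
  ext ⟨x, y⟩
  simp [bentWord_apply]

theorem two_mul_hammingNorm_bentWord_quadratic (hφ : φ ≠ 0) (a c : F) {b : F} (hb : b ≠ 0) :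
    2 * hammingNorm (bentWord φ (a, c, b)) + Fintype.card F =
      Fintype.card F * Fintype.card F +
        if φ (a * (-c / b)) ≠ 0 then 2 * Fintype.card F else 0 := by
  classical
  have h_fibers : hammingNorm (bentWord φ (a, c, b)) =
      ∑ x, hammingNorm fun y => bentWord φ (a, c, b) (x, y) := by
    simp only [hammingNorm, card_filter]
    exact Fintype.sum_prod_type _
  have h_balanced : ∀ x ≠ -c / b,
      2 * hammingNorm (fun y => bentWord φ (a, c, b) (x, y)) = Fintype.card F := by
    intro x hx
    have ht : b * x + c ≠ 0 := by
      contrapose! hx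
      rw [eq_div_iff hb]
      linear_combination hx
    rw [← two_mul_hammingNorm_functional _ (comp_mulLeft_ne_zero hφ ht) (φ (a * x))]
    congr 2
    ext y
    rw [bentWord_apply, LinearMap.comp_apply, LinearMap.mulLeft_apply, ← map_add]
    congr 1
    ring
  have h_constant : hammingNorm (fun y => bentWord φ (a, c, b) (-c / b, y)) =
      if φ (a * (-c / b)) ≠ 0 then Fintype.card F else 0 := by
    have : ∀ y, bentWord φ (a, c, b) (-c / b, y) = φ (a * (-c / b)) := by
      intro y
      rw [bentWord_apply]
      congr 1
      field_simp
      ring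
    simp only [this, hammingNorm]
    split_ifs with h <;> simp [h]
  rw [h_fibers, mul_sum, ← add_sum_erase _ _ (mem_univ (-c / b)), h_constant,
    sum_congr rfl fun x hx => h_balanced x (ne_of_mem_erase hx), sum_const,
    card_erase_of_mem (mem_univ _), card_univ, smul_eq_mul]
  obtain ⟨q, hq⟩ := Nat.exists_eq_succ_of_ne_zero (Fintype.card_ne_zero (α := F))
  rw [hq]
  split_ifs <;> simp <;> ring

theorem hammingNorm_bentWord_bounds (hφ : φ ≠ 0) {u : F × F × F} (hu : u ≠ 0) :
    Fintype.card F * Fintype.card F ≤ 2 * hammingNorm (bentWord φ u) + Fintype.card F ∧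
      2 * hammingNorm (bentWord φ u) ≤ Fintype.card F * Fintype.card F + Fintype.card F := by
  obtain ⟨a, c, b⟩ := u
  by_cases hb : b = 0
  · subst hb
    have h : a ≠ 0 ∨ c ≠ 0 := by
      contrapose! hu
      simp [hu.1, hu.2]
    have := two_mul_hammingNorm_bentWord_linear hφ h
    omega
  · have := two_mul_hammingNorm_bentWord_quadratic hφ a c hb
    split_ifs at this <;> omega

end BentCode

theorem hammingNorm_eq_add_sub_of_support_subset {ι : Type*} [Fintype ι] {u v : ι → ZMod 2}
    (h : ∀ i, v i ≠ 0 → u i ≠ 0) :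
    hammingNorm u = hammingNorm v + hammingNorm (u - v) := by
  have h_pointwise : ∀ s t : ZMod 2, (t ≠ 0 → s ≠ 0) →
      (if s ≠ 0 then 1 else 0) = (if t ≠ 0 then 1 else 0) + if s - t ≠ 0 then 1 else 0 := by
    decide
  simp only [hammingNorm, card_filter, ← sum_add_distrib]
  exact sum_congr rfl fun i _ => h_pointwise _ _ (h i)

/-- Bent words satisfy the Ashikhmin-Barg condition, so their supports are incomparable. -/
theorem eq_zero_or_eq_of_support_bentWord_subset {F : Type*} [Field F] [Algebra (ZMod 2) F]
    [Fintype F] {φ : F →ₗ[ZMod 2] ZMod 2} (hφ : φ ≠ 0) (hq : 4 ≤ Fintype.card F)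
    {u v : F × F × F} (hu : u ≠ 0)
    (h : ∀ p, bentWord φ v p ≠ 0 → bentWord φ u p ≠ 0) : v = 0 ∨ v = u := by
  by_contra! hv
  have h_sum := hammingNorm_eq_add_sub_of_support_subset h
  rw [← map_sub] at h_sum
  have h_u := hammingNorm_bentWord_bounds hφ hu
  have h_v := hammingNorm_bentWord_bounds hφ hv.1
  have h_diff := hammingNorm_bentWord_bounds hφ (sub_ne_zero.2 hv.2.symm)
  nlinarith

/-- The words `bentWord φ u`, punctured at the origin, with `k` extra copies of the coordinate
at `(1, 0)`. -/
def extendedBentWord {F : Type*} [Field F] [Algebra (ZMod 2) F] (φ : F →ₗ[ZMod 2] ZMod 2)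
    {n k : ℕ} (e : Fin n ≃ {p : F × F // p ≠ 0} ⊕ Fin k) :
    F × F × F →ₗ[ZMod 2] (Fin n → ZMod 2) :=
  LinearMap.funLeft (ZMod 2) (ZMod 2) (fun i => Sum.elim Subtype.val (fun _ => (1, 0)) (e i)) ∘ₗ
    bentWord φ

section ExtendedBentCode

variable {F : Type*} [Field F] [Algebra (ZMod 2) F] {φ : F →ₗ[ZMod 2] ZMod 2}
  {n k : ℕ} (e : Fin n ≃ {p : F × F // p ≠ 0} ⊕ Fin k)

theorem support_bentWord_subset_of_extended {u v : F × F × F}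
    (h : ∀ i, extendedBentWord φ e v i ≠ 0 → extendedBentWord φ e u i ≠ 0) (p : F × F)
    (hp : bentWord φ v p ≠ 0) : bentWord φ u p ≠ 0 := by
  have hp₀ : p ≠ 0 := by
    rintro rfl
    exact hp (bentWord_apply_zero φ v)
  have := h (e.symm (Sum.inl ⟨p, hp₀⟩))
  simp only [extendedBentWord, LinearMap.comp_apply, LinearMap.funLeft_apply,
    Equiv.apply_symm_apply, Sum.elim_inl] at this
  exact this hp

variable [Fintype F]

theorem hammingNorm_extendedBentWord (u : F × F × F) :
    hammingNorm (extendedBentWord φ e u) =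
      hammingNorm (bentWord φ u) + if φ u.1 ≠ 0 then k else 0 := by
  classical
  have h_point : bentWord φ u (1, 0) = φ u.1 := by
    simpa using bentWord_apply φ u.1 u.2.1 u.2.2 1 0
  have h_punctured : ∑ p : {p : F × F // p ≠ 0}, (if bentWord φ u p ≠ 0 then 1 else 0) =
      ∑ p, if bentWord φ u p ≠ 0 then 1 else 0 := by
    rw [← Fintype.sum_subtype_add_sum_subtype (fun p : F × F => p ≠ 0), left_eq_add]
    refine sum_eq_zero fun p _ => ?_
    rw [not_not.1 p.2, bentWord_apply_zero]
    simp
  simp only [hammingNorm, card_filter]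
  rw [← h_punctured, ← e.symm.sum_comp, Fintype.sum_sum_type]
  simp [extendedBentWord, LinearMap.funLeft_apply, h_point]

theorem extendedBentWord_injective (hφ : φ ≠ 0) (hq : 4 ≤ Fintype.card F) :
    Function.Injective (extendedBentWord φ e) := by
  rw [← LinearMap.ker_eq_bot, LinearMap.ker_eq_bot']
  intro u hu
  by_contra hu₀
  have h_norm := hammingNorm_extendedBentWord (φ := φ) e u
  rw [hu, hammingNorm_zero] at h_norm
  have h_bounds := hammingNorm_bentWord_bounds hφ hu₀
  rw [Nat.eq_zero_of_add_eq_zero_right h_norm.symm] at h_bounds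
  nlinarith

end ExtendedBentCode

/-- Proposition 4.2. -/
theorem minimal_code_violating_AB_from_Kasami
    {m : ℕ} (hm : 2 ≤ m)
    (n' : ℕ) (hn' : n' = 2 ^ (2 * m - 1) - 2 ^ m - 2 ^ (m - 1)) :
    ∃ C : Submodule (ZMod 2) (Fin (2 ^ (2 * m) - 1 + n') → ZMod 2),
      Module.finrank (ZMod 2) C = 3 * m ∧
      wmin C = 2 ^ (2 * m - 1) - 2 ^ (m - 1) ∧
      wmax C = 2 ^ (2 * m) - 2 ^ m ∧
      IsMinimalCode C ∧
      2 * wmin C ≤ (2 - 1) * wmax C := by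
  classical
  let F := GaloisField 2 m
  let _ : Fintype F := Fintype.ofFinite F
  have h_finrank : Module.finrank (ZMod 2) F = m := GaloisField.finrank 2 (by omega)
  have h_card : Fintype.card F = 2 ^ m := by
    rw [← Nat.card_eq_fintype_card]
    exact GaloisField.card 2 m (by omega)
  have hq : 4 ≤ Fintype.card F := by
    rw [h_card]
    exact Nat.pow_le_pow_right (n := 2) (by norm_num) hm
  have h_sq : Fintype.card F * Fintype.card F = 2 ^ (2 * m) := by
    rw [h_card, ← pow_add, two_mul]
  have h_half_sq : 2 * 2 ^ (2 * m - 1) = 2 ^ (2 * m) := by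
    rw [← pow_succ', Nat.sub_add_cancel (by omega)]
  have h_half : 2 * 2 ^ (m - 1) = 2 ^ m := by
    rw [← pow_succ', Nat.sub_add_cancel (by omega)]
  have h_four_mul : 4 * 2 ^ m ≤ 2 ^ (2 * m) := by
    rw [← h_sq, ← h_card]
    exact Nat.mul_le_mul_right _ hq
  obtain ⟨a₀, φ, hφa₀⟩ : ∃ (a₀ : F) (φ : F →ₗ[ZMod 2] ZMod 2), φ a₀ ≠ 0 := by
    by_contra! h
    exact one_ne_zero ((Module.forall_dual_apply_eq_zero_iff (ZMod 2) (1 : F)).1 (h 1))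
  have hφ : φ ≠ 0 := by
    rintro rfl
    exact hφa₀ rfl
  have e : Fin (2 ^ (2 * m) - 1 + n') ≃ {p : F × F // p ≠ 0} ⊕ Fin n' := by
    refine (Fintype.equivFinOfCardEq ?_).symm
    rw [Fintype.card_sum, Fintype.card_fin, Fintype.card_subtype_compl, Fintype.card_prod, h_sq,
      Fintype.card_subtype_eq]
  have h_weight := hammingNorm_extendedBentWord (φ := φ) e
  have h_wmin : wmin (LinearMap.range (extendedBentWord φ e)) =
      2 ^ (2 * m - 1) - 2 ^ (m - 1) := by
    refine IsLeast.csInf_eq ⟨⟨_, ⟨(0, 0, 1), rfl⟩, ?_, ?_⟩, ?_⟩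
    · rw [map_ne_zero_iff _ (extendedBentWord_injective e hφ hq)]
      simp
    · have := two_mul_hammingNorm_bentWord_quadratic hφ 0 0 one_ne_zero
      rw [h_weight]
      simp only [zero_mul, map_zero, ne_eq, not_true_eq_false, if_false] at this ⊢
      omega
    · rintro _ ⟨_, ⟨u, rfl⟩, hu, rfl⟩
      have := hammingNorm_bentWord_bounds hφ (u := u) (by rintro rfl; simp at hu)
      have := h_weight u
      omega
  have h_wmax : wmax (LinearMap.range (extendedBentWord φ e)) = 2 ^ (2 * m) - 2 ^ m := by
    refine IsGreatest.csSup_eq ⟨⟨_, ⟨(a₀, -1, 1), rfl⟩, ?_⟩, ?_⟩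
    · have := two_mul_hammingNorm_bentWord_quadratic hφ a₀ (-1) one_ne_zero
      rw [neg_neg, div_one, mul_one, if_pos hφa₀] at this
      rw [h_weight, if_pos hφa₀]
      omega
    · rintro _ ⟨_, ⟨u, rfl⟩, rfl⟩
      rw [h_weight]
      by_cases hu : u = 0
      · simp [hu]
      · have := hammingNorm_bentWord_bounds hφ hu
        split_ifs <;> omega
  refine ⟨LinearMap.range (extendedBentWord φ e), ?_, h_wmin, h_wmax, ?_, by omega⟩
  · rw [LinearMap.finrank_range_of_inj (extendedBentWord_injective e hφ hq),
      Module.finrank_prod, Module.finrank_prod, h_finrank]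
    omega
  · rintro _ ⟨u, rfl⟩ hu _ ⟨v, rfl⟩ h
    obtain rfl | rfl := eq_zero_or_eq_of_support_bentWord_subset hφ hq
      (u := u) (v := v) (by rintro rfl; simp at hu) (support_bentWord_subset_of_extended e h)
    · exact ⟨0, by simp⟩
    · exact ⟨1, by simp⟩
end

section
/- Let m ≥ 2 and h ≥ 1 be integers and set n' = 2^{3m+h−1} − 2^{2m} − 2^m. Then there exists a binary linear code (q = 2) with parameters [2^{3m+h} − 2^{2m} + n', 3m+h, 2^{3m+h−1} − 2^{2m−1} − 2^{m−1}]_2 and maximum weight 2^{3m+h} − 2^{2m} − 2^m that is a minimal code violating the Ashikhmin-Barg condition. -/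
open Finset BigOperators

theorem hammingNorm_comp_equiv {α β F : Type*} [Fintype α] [Fintype β] [Zero F] [DecidableEq F]
    (e : α ≃ β) (f : β → F) : hammingNorm (fun a => f (e a)) = hammingNorm f := by
  unfold hammingNorm
  exact Finset.card_equiv e (by simp)

theorem hammingNorm_sumElim {α β F : Type*} [Fintype α] [Fintype β] [Zero F] [DecidableEq F]
    (f : α → F) (g : β → F) :
    hammingNorm (Sum.elim f g : α ⊕ β → F) = hammingNorm f + hammingNorm g := by
  simp only [hammingNorm, Finset.card_filter, Fintype.sum_sum_type, Sum.elim_inl, Sum.elim_inr]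
  rfl

theorem hammingNorm_const {β F : Type*} [Fintype β] [Zero F] [DecidableEq F] (a : F) :
    hammingNorm (fun _ : β => a) = if a = 0 then 0 else Fintype.card β := by
  by_cases h : a = 0 <;> simp [hammingNorm, h]

/-- Nested supports of binary words: the weights of `c'` and `c - c'` add up to that of `c`. -/
theorem hammingNorm_sub_of_support_subset {ι : Type*} [Fintype ι] {c c' : ι → ZMod 2}
    (h : ∀ i, c' i ≠ 0 → c i ≠ 0) :
    hammingNorm c' + hammingNorm (c - c') = hammingNorm c := by
  simp only [hammingNorm, Finset.card_filter, ← Finset.sum_add_distrib, Pi.sub_apply]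
  refine Finset.sum_congr rfl fun i _ => ?_
  have key : ∀ a b : ZMod 2, (b ≠ 0 → a ≠ 0) →
      (if b ≠ 0 then 1 else 0) + (if a - b ≠ 0 then 1 else 0) = if a ≠ 0 then 1 else 0 := by
    decide
  exact key _ _ (h i)

/-- Appending `r` copies of a coordinate `ℓ` to a binary code whose nonzero weights lie in `[L, M]`
with `M < 2 * L` keeps minimality; if `M + r = 2 * L` and the extreme weights are attained at
suitable codewords, the new minimum and maximum weights are `L` and `M + r`. -/
theorem exists_minimalCode_of_repeated_coordinate {V ι : Type*} [AddCommGroup V] [Module (ZMod 2) V]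
    [Fintype ι] (φ : V →ₗ[ZMod 2] (ι → ZMod 2)) (ℓ : V →ₗ[ZMod 2] ZMod 2) {L M r N : ℕ}
    (hN : Fintype.card ι + r = N) (hL : ∀ x, x ≠ 0 → L ≤ hammingNorm (φ x))
    (hM : ∀ x, hammingNorm (φ x) ≤ M) (hLM : M < 2 * L)
    {x₀ x₁ : V} (h₀ : hammingNorm (φ x₀) = L) (hℓ₀ : ℓ x₀ = 0)
    (h₁ : hammingNorm (φ x₁) = M) (hℓ₁ : ℓ x₁ = 1) :
    ∃ C : Submodule (ZMod 2) (Fin N → ZMod 2),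
      Module.finrank (ZMod 2) C = Module.finrank (ZMod 2) V ∧
      wmin C = L ∧ wmax C = M + r ∧ IsMinimalCode C := by
  have e : Fin N ≃ ι ⊕ Fin r := Fintype.equivOfCardEq (by simp [hN])
  let ψ : V →ₗ[ZMod 2] (Fin N → ZMod 2) :=
    LinearMap.pi fun j => Sum.elim (fun i => LinearMap.proj i ∘ₗ φ) (fun _ => ℓ) (e j)
  have hψ : ∀ x j, ψ x j = Sum.elim (φ x) (fun _ => ℓ x) (e j) := by
    intro x j
    simp only [ψ, LinearMap.pi_apply]
    rcases e j with i | i <;> simp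
  have hwt : ∀ x, hammingNorm (ψ x) = hammingNorm (φ x) + if ℓ x = 0 then 0 else r := by
    intro x
    have : ψ x = fun j => (Sum.elim (φ x) (fun _ => ℓ x) : ι ⊕ Fin r → ZMod 2) (e j) :=
      funext (hψ x)
    rw [this, hammingNorm_comp_equiv, hammingNorm_sumElim, hammingNorm_const, Fintype.card_fin]
  have hLpos : 0 < L := by omega
  have hinj : Function.Injective ψ := by
    rw [injective_iff_map_eq_zero]
    intro x hx
    by_contra hne
    have h1 := hL x hne
    have h2 := hwt x
    rw [hx, hammingNorm_zero] at h2
    omega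
  have hψne : ∀ x, ψ x ≠ 0 → x ≠ 0 := by
    rintro x hx rfl
    exact hx (map_zero ψ)
  refine ⟨LinearMap.range ψ, LinearMap.finrank_range_of_inj hinj, ?_, ?_, ?_⟩
  · refine IsLeast.csInf_eq ⟨⟨ψ x₀, ⟨x₀, rfl⟩, ?_, ?_⟩, ?_⟩
    · rw [← hammingNorm_pos_iff, hwt]
      omega
    · rw [hwt, h₀, if_pos hℓ₀, add_zero]
    · rintro w ⟨_, ⟨x, rfl⟩, hne, rfl⟩
      rw [hwt]
      exact (hL x (hψne x hne)).trans (Nat.le_add_right _ _)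
  · refine IsGreatest.csSup_eq ⟨⟨ψ x₁, ⟨x₁, rfl⟩, ?_⟩, ?_⟩
    · rw [hwt, h₁, hℓ₁, if_neg one_ne_zero]
    · rintro w ⟨_, ⟨x, rfl⟩, rfl⟩
      rw [hwt]
      have := hM x
      split_ifs <;> omega
  · rintro _ ⟨x, rfl⟩ _ _ ⟨y, rfl⟩ hsub
    by_cases hy : y = 0
    · exact ⟨0, by simp [hy]⟩
    by_cases hxy : x - y = 0
    · exact ⟨1, by rw [sub_eq_zero.mp hxy, one_smul]⟩
    have hnest : ∀ i, φ y i ≠ 0 → φ x i ≠ 0 := by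
      intro i hi
      have hj : e.symm (Sum.inl i) ∈ {j | ψ y j ≠ 0} := by simpa [hψ] using hi
      simpa [hψ] using hsub hj
    have hsum := hammingNorm_sub_of_support_subset hnest
    rw [← map_sub] at hsum
    have := hL y hy
    have := hL _ hxy
    have := hM x
    omega

theorem two_mul_card_fiber_of_ne_zero {V : Type*} [AddCommGroup V] [Module (ZMod 2) V] [Fintype V]
    {f : V →ₗ[ZMod 2] ZMod 2} (hf : f ≠ 0) (s : ZMod 2) :
    2 * #{v | f v = s} = Fintype.card V := by
  obtain ⟨v₀, hv₀⟩ : ∃ v, f v ≠ 0 := by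
    by_contra! h
    exact hf (LinearMap.ext h)
  have hshift : #{v | f v = s} = #{v | ¬ f v = s} := by
    refine Finset.card_equiv (Equiv.addRight v₀) fun v => ?_
    have key : ∀ a b c : ZMod 2, b ≠ 0 → (a = c ↔ ¬ a + b = c) := by decide
    simpa using key (f v) (f v₀) s hv₀
  rw [two_mul]
  nth_rewrite 2 [hshift]
  rw [Finset.card_filter_add_card_filter_not, Finset.card_univ]

/-- Evaluation of linear functionals at the points outside the range of `d`. -/
def complementEval {V : Type*} [AddCommGroup V] [Module (ZMod 2) V] {W P : Type*}
    [AddCommGroup W] [Module (ZMod 2) W] (B : W →ₗ[ZMod 2] V →ₗ[ZMod 2] ZMod 2) (d : P → V) :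
    W →ₗ[ZMod 2] ({v // v ∉ Set.range d} → ZMod 2) :=
  LinearMap.pi fun v => B.flip v.1

theorem two_mul_hammingNorm_complementEval {V W P : Type*} [AddCommGroup V] [Module (ZMod 2) V]
    [Fintype V] [AddCommGroup W] [Module (ZMod 2) W] [Fintype P]
    (B : W →ₗ[ZMod 2] V →ₗ[ZMod 2] ZMod 2) {d : P → V} [Fintype {v // v ∉ Set.range d}]
    (hd : Function.Injective d) {x : W} (hx : B x ≠ 0) :
    2 * (hammingNorm (complementEval B d x) + #{p | B x (d p) = 1}) = Fintype.card V := by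
  classical
  rw [← two_mul_card_fiber_of_ne_zero hx 1]
  congr 1
  have hne : ∀ a : ZMod 2, a ≠ 0 ↔ a = 1 := by decide
  have h1 : hammingNorm (complementEval B d x) = #{v | B x v = 1 ∧ v ∉ Set.range d} := by
    simp only [hammingNorm, hne]
    refine Finset.card_bij (fun v _ => v.1) ?_ (fun _ _ _ _ h => Subtype.ext h) ?_
    · intro v hv
      have hv' : B x v.1 = 1 := (Finset.mem_filter.mp hv).2
      simpa only [Finset.mem_filter, Finset.mem_univ, true_and] using And.intro hv' v.2
    · intro v hv
      simp only [Finset.mem_filter, Finset.mem_univ, true_and] at hv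
      exact ⟨⟨v, hv.2⟩, Finset.mem_filter.mpr ⟨Finset.mem_univ _, hv.1⟩, rfl⟩
  have h2 : #{p | B x (d p) = 1} = #{v | B x v = 1 ∧ v ∈ Set.range d} := by
    refine Finset.card_bij (fun p _ => d p) ?_ (fun _ _ _ _ h => hd h) ?_
    · intro p hp
      simpa using hp
    · intro v hv
      simp only [Finset.mem_filter, Finset.mem_univ, true_and] at hv
      obtain ⟨hv, p, rfl⟩ := hv
      exact ⟨p, by simpa using hv, rfl⟩
  rw [h1, h2, add_comm, ← Finset.filter_filter, ← Finset.filter_filter,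
    Finset.card_filter_add_card_filter_not]

/-- The standard inner product on pairs of binary vectors, one more bit, and a binary tail. -/
def tupleDot (m n : ℕ) :
    ((Fin m → ZMod 2) × (Fin m → ZMod 2) × ZMod 2 × (Fin n → ZMod 2)) →ₗ[ZMod 2]
      ((Fin m → ZMod 2) × (Fin m → ZMod 2) × ZMod 2 × (Fin n → ZMod 2)) →ₗ[ZMod 2] ZMod 2 :=
  LinearMap.mk₂ (ZMod 2)
    (fun x v => x.1 ⬝ᵥ v.1 + x.2.1 ⬝ᵥ v.2.1 + x.2.2.1 * v.2.2.1 + x.2.2.2 ⬝ᵥ v.2.2.2)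
    (fun x y v => by simp only [Prod.fst_add, Prod.snd_add, add_dotProduct]; ring)
    (fun c x v => by
      simp only [Prod.smul_fst, Prod.smul_snd, smul_dotProduct, smul_eq_mul]; ring)
    (fun x v w => by simp only [Prod.fst_add, Prod.snd_add, dotProduct_add]; ring)
    (fun c x v => by
      simp only [Prod.smul_fst, Prod.smul_snd, dotProduct_smul, smul_eq_mul]; ring)

theorem tupleDot_apply {m n : ℕ}
    (x v : (Fin m → ZMod 2) × (Fin m → ZMod 2) × ZMod 2 × (Fin n → ZMod 2)) :
    tupleDot m n x v =
      x.1 ⬝ᵥ v.1 + x.2.1 ⬝ᵥ v.2.1 + x.2.2.1 * v.2.2.1 + x.2.2.2 ⬝ᵥ v.2.2.2 :=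
  rfl

theorem tupleDot_ne_zero {m n : ℕ}
    {x : (Fin m → ZMod 2) × (Fin m → ZMod 2) × ZMod 2 × (Fin n → ZMod 2)} (hx : x ≠ 0) :
    tupleDot m n x ≠ 0 := by
  contrapose! hx
  have h : ∀ v, tupleDot m n x v = 0 := fun v => by rw [hx, LinearMap.zero_apply]
  simp only [tupleDot_apply] at h
  refine Prod.ext ?_ (Prod.ext ?_ (Prod.ext ?_ ?_))
  · exact dotProduct_eq_zero _ fun w => by simpa using h (w, 0, 0, 0)
  · exact dotProduct_eq_zero _ fun w => by simpa using h (0, w, 0, 0)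
  · simpa using h (0, 0, 1, 0)
  · exact dotProduct_eq_zero _ fun w => by simpa using h (0, 0, 0, w)

/-- The graph of the inner product, a bent function of `2 * m` variables. -/
def innerGraph (m n : ℕ) (p : (Fin m → ZMod 2) × (Fin m → ZMod 2)) :
    (Fin m → ZMod 2) × (Fin m → ZMod 2) × ZMod 2 × (Fin n → ZMod 2) :=
  (p.1, p.2, p.1 ⬝ᵥ p.2, 0)

theorem innerGraph_injective (m n : ℕ) : Function.Injective (innerGraph m n) := by
  rintro ⟨p, q⟩ ⟨p', q'⟩ h
  simp only [innerGraph, Prod.mk.injEq] at h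
  rw [h.1, h.2.1]

theorem two_mul_card_dotProduct_eq_one {m : ℕ} {a : Fin m → ZMod 2} (ha : a ≠ 0) (s : ZMod 2) :
    2 * #{q : Fin m → ZMod 2 | a ⬝ᵥ q = s} = 2 ^ m := by
  have hf : dotProductBilin (ZMod 2) (ZMod 2) a ≠ 0 := by
    contrapose! ha
    exact dotProduct_eq_zero _ fun w => by
      simpa using congrArg (fun f : (Fin m → ZMod 2) →ₗ[ZMod 2] ZMod 2 => f w) ha
  simpa [ZMod.card] using two_mul_card_fiber_of_ne_zero hf s

theorem two_mul_card_inner_add_linear {m : ℕ} (a b : Fin m → ZMod 2) :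
    2 * #{p : (Fin m → ZMod 2) × (Fin m → ZMod 2) | a ⬝ᵥ p.1 + b ⬝ᵥ p.2 + p.1 ⬝ᵥ p.2 = 1} + 2 ^ m
      = 2 ^ m * 2 ^ m + if a ⬝ᵥ b = 1 then 2 * 2 ^ m else 0 := by
  have hfib : ∀ p : Fin m → ZMod 2,
      2 * #{q : Fin m → ZMod 2 | a ⬝ᵥ p + b ⬝ᵥ q + p ⬝ᵥ q = 1} + (if p = b then 2 ^ m else 0)
        = 2 ^ m + if p = b then (if a ⬝ᵥ b = 1 then 2 * 2 ^ m else 0) else 0 := by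
    intro p
    have hchar : ∀ s t : ZMod 2, s + t = 1 ↔ t = 1 - s := by decide
    simp only [add_assoc, ← add_dotProduct, hchar]
    split_ifs with hp hab
    · subst hp
      simp [hab, CharTwo.add_self_eq_zero, ZMod.card]
      ring
    · subst hp
      have h01 : ∀ s : ZMod 2, s ≠ 1 → ¬ 0 = 1 - s := by decide
      simp [h01 _ hab, CharTwo.add_self_eq_zero]
    · rw [two_mul_card_dotProduct_eq_one]
      contrapose! hp
      funext i
      exact (CharTwo.add_eq_zero.mp (congrFun hp i)).symm
  have hsum := Finset.sum_congr rfl fun p (_ : p ∈ (Finset.univ : Finset (Fin m → ZMod 2))) => hfib p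
  simp only [Finset.sum_add_distrib, ← Finset.mul_sum, Finset.sum_ite_eq', Finset.mem_univ, if_true,
    Finset.sum_const, Finset.card_univ, Fintype.card_fun, ZMod.card, Fintype.card_fin,
    smul_eq_mul] at hsum
  rw [← hsum, Finset.card_filter, Fintype.sum_prod_type]
  simp only [Finset.card_filter]

theorem two_mul_card_linear_le {m : ℕ} (a b : Fin m → ZMod 2) :
    2 * #{p : (Fin m → ZMod 2) × (Fin m → ZMod 2) | a ⬝ᵥ p.1 + b ⬝ᵥ p.2 = 1} ≤ 2 ^ m * 2 ^ m := by
  let f : (Fin m → ZMod 2) × (Fin m → ZMod 2) →ₗ[ZMod 2] ZMod 2 :=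
    (dotProductBilin (ZMod 2) (ZMod 2) a).coprod (dotProductBilin (ZMod 2) (ZMod 2) b)
  have hf : ∀ p, f p = a ⬝ᵥ p.1 + b ⬝ᵥ p.2 := fun p => by simp [f]
  simp only [← hf]
  by_cases h : f = 0
  · simp [h]
  · rw [two_mul_card_fiber_of_ne_zero h]
    simp [ZMod.card]

theorem two_mul_card_tupleDot_innerGraph_le {m n : ℕ}
    (x : (Fin m → ZMod 2) × (Fin m → ZMod 2) × ZMod 2 × (Fin n → ZMod 2)) :
    2 * #{p | tupleDot m n x (innerGraph m n p) = 1} ≤ 2 ^ m * 2 ^ m + 2 ^ m := by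
  obtain ⟨a, b, c, u⟩ := x
  simp only [tupleDot_apply, innerGraph, dotProduct_zero, add_zero]
  have hc : c = 0 ∨ c = 1 := by revert c; decide
  rcases hc with rfl | rfl
  · simp only [zero_mul, add_zero]
    exact (two_mul_card_linear_le a b).trans (Nat.le_add_right _ _)
  · have := two_mul_card_inner_add_linear a b
    simp only [one_mul]
    generalize 2 ^ m = r at this ⊢
    split_ifs at this <;> linarith

/-- Proposition 4.3. -/
theorem minimal_code_violating_AB_from_Kasami_complementary
    {m h : ℕ} (hm : 2 ≤ m) (hh : 1 ≤ h)
    (n' : ℕ) (hn' : n' = 2 ^ (3 * m + h - 1) - 2 ^ (2 * m) - 2 ^ m) :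
    ∃ C : Submodule (ZMod 2) (Fin (2 ^ (3 * m + h) - 2 ^ (2 * m) + n') → ZMod 2),
      Module.finrank (ZMod 2) C = 3 * m + h ∧
      wmin C = 2 ^ (3 * m + h - 1) - 2 ^ (2 * m - 1) - 2 ^ (m - 1) ∧
      wmax C = 2 ^ (3 * m + h) - 2 ^ (2 * m) - 2 ^ m ∧
      IsMinimalCode C ∧
      2 * wmin C ≤ (2 - 1) * wmax C := by
  classical
  obtain ⟨n, rfl⟩ : ∃ n, m = n + 1 := ⟨m - 1, by omega⟩
  obtain ⟨t, rfl⟩ : ∃ t, h = t + 1 := ⟨h - 1, by omega⟩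
  have hP : 4 ≤ 2 ^ (n + 1) := by
    calc 4 = 2 ^ 2 := by norm_num
      _ ≤ 2 ^ (n + 1) := Nat.pow_le_pow_right (by norm_num) hm
  have e₁ : 2 ^ (3 * (n + 1) + (t + 1)) = 2 * 2 ^ (3 * (n + 1) + t) := by ring
  have e₂ : 2 ^ (2 * (n + 1)) = 2 ^ (n + 1) * 2 ^ (n + 1) := by ring
  have e₃ : 2 * 2 ^ (2 * (n + 1) - 1) = 2 ^ (n + 1) * 2 ^ (n + 1) := by
    rw [show 2 * (n + 1) - 1 = 2 * n + 1 by omega]; ring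
  have e₄ : 2 * 2 ^ (n + 1 - 1) = 2 ^ (n + 1) := by
    rw [Nat.add_sub_cancel]; ring
  have e₅ : 2 ^ (n + 1) * 2 ^ (n + 1) + 2 ^ (n + 1) < 2 ^ (3 * (n + 1) + t) := by
    have : 2 ^ (3 * (n + 1) + t) = 2 ^ t * 2 ^ (n + 1) * (2 ^ (n + 1) * 2 ^ (n + 1)) := by ring
    have : 1 ≤ 2 ^ t := Nat.one_le_two_pow
    nlinarith [Nat.mul_le_mul this hP, Nat.zero_le (2 ^ (n + 1) * 2 ^ (n + 1))]
  rw [show 3 * (n + 1) + (t + 1) - 1 = 3 * (n + 1) + t by omega] at hn' ⊢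
  have hcard : Fintype.card ((Fin (n + 1) → ZMod 2) × (Fin (n + 1) → ZMod 2) × ZMod 2 ×
      (Fin (n + t + 1) → ZMod 2)) = 2 * 2 ^ (3 * (n + 1) + t) := by
    simp only [Fintype.card_prod, Fintype.card_fun, ZMod.card, Fintype.card_fin]
    ring
  have hrank : Module.finrank (ZMod 2) ((Fin (n + 1) → ZMod 2) × (Fin (n + 1) → ZMod 2) × ZMod 2 ×
      (Fin (n + t + 1) → ZMod 2)) = 3 * (n + 1) + (t + 1) := by
    simp only [Module.finrank_prod, Module.finrank_fin_fun, Module.finrank_self]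
    ring
  have hdinj := innerGraph_injective (n + 1) (n + t + 1)
  have hι : Fintype.card {v // v ∉ Set.range (innerGraph (n + 1) (n + t + 1))} + n' =
      2 ^ (3 * (n + 1) + (t + 1)) - 2 ^ (2 * (n + 1)) + n' := by
    have hr : Fintype.card {v // v ∈ Set.range (innerGraph (n + 1) (n + t + 1))} =
        2 ^ (n + 1) * 2 ^ (n + 1) := by
      rw [← Fintype.card_congr (Equiv.ofInjective _ hdinj)]
      simp [ZMod.card]
    rw [Fintype.card_subtype_compl, hr, hcard, e₁, e₂]
  set φ := complementEval (tupleDot (n + 1) (n + t + 1)) (innerGraph (n + 1) (n + t + 1))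
  have hwt : ∀ x, x ≠ 0 → 2 * (hammingNorm (φ x) +
      #{p | tupleDot (n + 1) (n + t + 1) x (innerGraph (n + 1) (n + t + 1) p) = 1}) =
      2 * 2 ^ (3 * (n + 1) + t) := fun x hx => by
    rw [← hcard]
    exact two_mul_hammingNorm_complementEval _ hdinj (tupleDot_ne_zero hx)
  have hx₀ := hwt (Pi.single 0 1, Pi.single 0 1, 1, 0) (by simp)
  have hx₁ := hwt (0, 0, 0, Pi.single 0 1) (by simp)
  have hbent := two_mul_card_inner_add_linear (m := n + 1) (Pi.single 0 1) (Pi.single 0 1)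
  rw [if_pos (by simp)] at hbent
  simp only [tupleDot_apply, innerGraph, dotProduct_zero, add_zero, one_mul] at hx₀
  simp only [tupleDot_apply, innerGraph, dotProduct_zero, zero_dotProduct, zero_mul, add_zero,
    zero_ne_one, Finset.filter_false, Finset.card_empty] at hx₁
  obtain ⟨C, hdim, hmin, hmax, hC⟩ := exists_minimalCode_of_repeated_coordinate φ
    (LinearMap.proj 0 ∘ₗ LinearMap.snd _ _ _ ∘ₗ LinearMap.snd _ _ _ ∘ₗ LinearMap.snd _ _ _)
    (L := 2 ^ (3 * (n + 1) + t) - 2 ^ (2 * (n + 1) - 1) - 2 ^ (n + 1 - 1))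
    (M := 2 ^ (3 * (n + 1) + t)) hι
    (fun x hx => by
      have := hwt x hx
      have := two_mul_card_tupleDot_innerGraph_le x
      omega)
    (fun x => by
      by_cases hx : x = 0
      · simp [hx]
      · have := hwt x hx
        omega)
    (by omega)
    (x₀ := (Pi.single 0 1, Pi.single 0 1, 1, 0)) (x₁ := (0, 0, 0, Pi.single 0 1))
    (by omega) (by simp) (by omega) (by simp)
  refine ⟨C, hdim.trans hrank, hmin, ?_, hC, ?_⟩
  · rw [hmax]
    omega
  · rw [hmin, hmax]
    omega
end

section
/- Let l and m be positive integers such that l divides m, m/l is odd, and l < m − 2 (note that m + l is then even). Set n' = 2^{m−2} − 3·2^{(m+l−4)/2}. Then there exists a binary linear code (q = 2) with parameters [2^{m−1} − 1 + n', m, 2^{m−2} − 2^{(m+l−4)/2}]_2 and maximum weight 2^{m−1} − 2^{(m+l−2)/2} that is a minimal code violating the Ashikhmin-Barg condition. -/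
open Finset BigOperators

/-- The nontrivial additive character of `ZMod 2`, with values in `ℤ`. -/
def binarySign (x : ZMod 2) : ℤ := if x = 0 then 1 else -1

lemma binarySign_add (x y : ZMod 2) : binarySign (x + y) = binarySign x * binarySign y := by
  revert x y; decide

lemma binarySign_sum {ι : Type*} (s : Finset ι) (f : ι → ZMod 2) :
    binarySign (∑ i ∈ s, f i) = ∏ i ∈ s, binarySign (f i) := by
  classical
  induction s using Finset.induction_on with
  | empty => simp [binarySign]
  | insert i s hi ih => rw [Finset.sum_insert hi, Finset.prod_insert hi, binarySign_add, ih]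

/-- Orthogonality of characters on `(ZMod 2)^n`. -/
lemma sum_binarySign_dotProduct {n : ℕ} (w : Fin n → ZMod 2) :
    ∑ b : Fin n → ZMod 2, binarySign (w ⬝ᵥ b) = if w = 0 then 2 ^ n else 0 := by
  have key : ∀ c : ZMod 2, ∑ b : ZMod 2, binarySign (c * b) = if c = 0 then 2 else 0 := by
    decide
  calc ∑ b : Fin n → ZMod 2, binarySign (w ⬝ᵥ b)
      = ∑ b : Fin n → ZMod 2, ∏ i, binarySign (w i * b i) := by
        simp only [dotProduct, binarySign_sum]
    _ = ∏ i, ∑ c : ZMod 2, binarySign (w i * c) :=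
        (Fintype.prod_sum fun i (c : ZMod 2) => binarySign (w i * c)).symm
    _ = ∏ i, if w i = 0 then 2 else 0 := by simp only [key]
    _ = if w = 0 then 2 ^ n else 0 := by
        split_ifs with hw
        · simp [hw]
        · obtain ⟨i, hi⟩ := Function.ne_iff.mp hw
          exact Finset.prod_eq_zero (Finset.mem_univ i) (if_neg hi)

lemma hammingNorm_eq_sum {ι : Type*} [Fintype ι] (f : ι → ZMod 2) :
    hammingNorm f = ∑ i, if f i = 0 then 0 else 1 := by
  rw [hammingNorm, Finset.card_filter]
  exact Finset.sum_congr rfl fun i _ => by by_cases h : f i = 0 <;> simp [h]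

lemma two_mul_hammingNorm {ι : Type*} [Fintype ι] (f : ι → ZMod 2) :
    2 * (hammingNorm f : ℤ) = Fintype.card ι - ∑ i, binarySign (f i) := by
  rw [hammingNorm_eq_sum, Fintype.card_eq_sum_ones]
  push_cast
  rw [← Finset.sum_sub_distrib, Finset.mul_sum]
  exact Finset.sum_congr rfl fun i _ => by by_cases h : f i = 0 <;> simp [h, binarySign]

lemma hammingNorm_eq_add_sub {ι : Type*} [Fintype ι] {f g : ι → ZMod 2}
    (h : ∀ i, g i ≠ 0 → f i ≠ 0) : hammingNorm f = hammingNorm g + hammingNorm (f - g) := by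
  have key : ∀ x y : ZMod 2, (y ≠ 0 → x ≠ 0) →
      (if x = 0 then 0 else 1) = (if y = 0 then 0 else 1) + if x - y = 0 then 0 else 1 := by
    decide
  simp only [hammingNorm_eq_sum, ← Finset.sum_add_distrib]
  exact Finset.sum_congr rfl fun i _ => key _ _ (h i)

lemma hammingNorm_comp_equiv_s7 {ι κ : Type*} [Fintype ι] [Fintype κ] (e : κ ≃ ι)
    (f : ι → ZMod 2) : hammingNorm (f ∘ e) = hammingNorm f := by
  simp only [hammingNorm_eq_sum, Function.comp_apply]
  exact e.sum_comp fun i => if f i = 0 then 0 else 1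

section Range

variable {P : Type*} [AddCommGroup P] [Module (ZMod 2) P] {n : ℕ}

lemma wmin_range (f : P →ₗ[ZMod 2] (Fin n → ZMod 2)) (hf : Function.Injective f) {a : ℕ} {p : P}
    (hp : p ≠ 0) (hpa : hammingNorm (f p) = a) (hle : ∀ q, q ≠ 0 → a ≤ hammingNorm (f q)) :
    wmin (LinearMap.range f) = a := by
  refine IsLeast.csInf_eq ⟨⟨f p, ⟨p, rfl⟩, (map_ne_zero_iff f hf).mpr hp, hpa⟩, ?_⟩
  rintro _ ⟨_, ⟨q, rfl⟩, hq, rfl⟩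
  exact hle q ((map_ne_zero_iff f hf).mp hq)

lemma wmax_range (f : P →ₗ[ZMod 2] (Fin n → ZMod 2)) {a : ℕ} {p : P}
    (hpa : hammingNorm (f p) = a) (hle : ∀ q, hammingNorm (f q) ≤ a) :
    wmax (LinearMap.range f) = a := by
  refine IsGreatest.csSup_eq ⟨⟨f p, ⟨p, rfl⟩, hpa⟩, ?_⟩
  rintro _ ⟨_, ⟨q, rfl⟩, rfl⟩
  exact hle q

end Range

/-- The functions `(a, b, z) ↦ u ⬝ᵥ a + v ⬝ᵥ b + t * (a ⬝ᵥ b) + w ⬝ᵥ z`, parametrised linearly by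
`(u, v, t, w)`. For `t = 1`, `w = 0` and `k = 0` they are bent. -/
def bentFamily (r k : ℕ) :
    ((Fin r → ZMod 2) × (Fin r → ZMod 2) × ZMod 2 × (Fin k → ZMod 2)) →ₗ[ZMod 2]
      ((Fin r → ZMod 2) × (Fin r → ZMod 2) × (Fin k → ZMod 2) → ZMod 2) where
  toFun p x := p.1 ⬝ᵥ x.1 + p.2.1 ⬝ᵥ x.2.1 + p.2.2.1 * (x.1 ⬝ᵥ x.2.1) + p.2.2.2 ⬝ᵥ x.2.2
  map_add' p q := by
    ext x
    simp only [Prod.fst_add, Prod.snd_add, add_dotProduct, Pi.add_apply]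
    ring
  map_smul' c p := by
    ext x
    simp only [Prod.smul_fst, Prod.smul_snd, smul_dotProduct, Pi.smul_apply, smul_eq_mul,
      RingHom.id_apply]
    ring

lemma bentFamily_apply {r k : ℕ} (u v : Fin r → ZMod 2) (t : ZMod 2) (w : Fin k → ZMod 2)
    (a b : Fin r → ZMod 2) (z : Fin k → ZMod 2) :
    bentFamily r k (u, v, t, w) (a, b, z) = u ⬝ᵥ a + v ⬝ᵥ b + t * (a ⬝ᵥ b) + w ⬝ᵥ z := rfl

lemma bentFamily_zero_right {r k : ℕ} (p) : bentFamily r k p 0 = 0 := by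
  simp [bentFamily]

lemma sum_binarySign_bentFamily {r k : ℕ} (u v : Fin r → ZMod 2) (t : ZMod 2)
    (w : Fin k → ZMod 2) :
    ∑ x, binarySign (bentFamily r k (u, v, t, w) x) =
      (∑ a, binarySign (u ⬝ᵥ a) * if v + t • a = 0 then 2 ^ r else 0) *
        if w = 0 then 2 ^ k else 0 := by
  rw [← sum_binarySign_dotProduct w, Fintype.sum_prod_type, Finset.sum_mul]
  refine Finset.sum_congr rfl fun a _ => ?_
  rw [← sum_binarySign_dotProduct (v + t • a), Fintype.sum_prod_type, mul_assoc,
    Finset.sum_mul_sum, Finset.mul_sum]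
  refine Finset.sum_congr rfl fun b _ => ?_
  rw [Finset.mul_sum]
  refine Finset.sum_congr rfl fun z _ => ?_
  rw [bentFamily_apply, binarySign_add, ← mul_assoc, ← binarySign_add (u ⬝ᵥ a), add_dotProduct, smul_dotProduct,
    smul_eq_mul, add_assoc (u ⬝ᵥ a)]

lemma sum_binarySign_bentFamily_one {r k : ℕ} (u v : Fin r → ZMod 2) (w : Fin k → ZMod 2) :
    ∑ x, binarySign (bentFamily r k (u, v, 1, w) x) =
      binarySign (u ⬝ᵥ v) * 2 ^ r * if w = 0 then 2 ^ k else 0 := by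
  have hv : ∀ a : Fin r → ZMod 2, v + (1 : ZMod 2) • a = 0 ↔ a = v := fun a => by
    rw [one_smul, ← ZModModule.sub_eq_add, sub_eq_zero, eq_comm]
  simp only [sum_binarySign_bentFamily, hv]
  simp

lemma sum_binarySign_bentFamily_zero {r k : ℕ} {u v : Fin r → ZMod 2} {w : Fin k → ZMod 2}
    (h : (u, v, (0 : ZMod 2), w) ≠ 0) :
    ∑ x, binarySign (bentFamily r k (u, v, 0, w) x) = 0 := by
  rw [sum_binarySign_bentFamily]
  by_cases hw : w = 0
  · by_cases hv : v = 0
    · have hu : u ≠ 0 := by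
        rintro rfl
        exact h (by simp [hv, hw])
      simp [hv, ← Finset.sum_mul, sum_binarySign_dotProduct, hu]
    · simp [hv]
  · simp [hw]

lemma abs_sum_binarySign_bentFamily_le {r k : ℕ} {p} (hp : p ≠ 0) :
    |∑ x, binarySign (bentFamily r k p x)| ≤ 2 ^ (r + k) := by
  obtain ⟨u, v, t, w⟩ := p
  obtain rfl | rfl : t = 0 ∨ t = 1 := by clear hp; revert t; decide
  · rw [sum_binarySign_bentFamily_zero hp]
    simp
  · rw [sum_binarySign_bentFamily_one, abs_mul, abs_mul, pow_add]
    have hs : |binarySign (u ⬝ᵥ v)| = 1 := by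
      unfold binarySign
      split_ifs <;> simp
    split_ifs <;> simp [hs]

lemma two_mul_hammingNorm_bentFamily {r k : ℕ} (p) :
    2 * (hammingNorm (bentFamily r k p) : ℤ) =
      2 ^ (2 * r + k) - ∑ x, binarySign (bentFamily r k p x) := by
  rw [two_mul_hammingNorm]
  simp only [Fintype.card_prod, Fintype.card_fun, ZMod.card, Fintype.card_fin]
  push_cast
  ring

/-- The coordinates of `bentFamily` away from the origin, followed by `n` copies of the linear
functional `h`. -/
def extendedBentFamily (r k n : ℕ)
    (h : ((Fin r → ZMod 2) × (Fin r → ZMod 2) × ZMod 2 × (Fin k → ZMod 2)) →ₗ[ZMod 2] ZMod 2) :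
    ((Fin r → ZMod 2) × (Fin r → ZMod 2) × ZMod 2 × (Fin k → ZMod 2)) →ₗ[ZMod 2]
      ({x : (Fin r → ZMod 2) × (Fin r → ZMod 2) × (Fin k → ZMod 2) // x ≠ 0} ⊕ Fin n → ZMod 2) :=
  LinearMap.pi (Sum.elim (fun x => LinearMap.proj x.1 ∘ₗ bentFamily r k) fun _ => h)

lemma hammingNorm_extendedBentFamily {r k n : ℕ} (h) (p) :
    hammingNorm (extendedBentFamily r k n h p) =
      hammingNorm (bentFamily r k p) + if h p = 0 then 0 else n := by
  have hl : ∀ x, extendedBentFamily r k n h p (Sum.inl x) = bentFamily r k p x.1 := fun _ => rfl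
  have hr : ∀ i, extendedBentFamily r k n h p (Sum.inr i) = h p := fun _ => rfl
  simp only [hammingNorm_eq_sum, Fintype.sum_sum_type, hl, hr]
  congr 1
  · rw [← Finset.sum_erase Finset.univ
      (f := fun x => if bentFamily r k p x = 0 then 0 else 1) (a := 0)
      (by simp [bentFamily_zero_right])]
    exact (Finset.sum_subtype (Finset.univ.erase 0) (fun x => by simp)
      fun x => if bentFamily r k p x = 0 then 0 else 1).symm
  · by_cases hp : h p = 0 <;> simp [hp]

/-- Proposition 4.4. -/
theorem minimal_code_violating_AB_from_three_weight
    {l m : ℕ} (hl : 1 ≤ l) (hdvd : l ∣ m) (hodd : Odd (m / l)) (hlm : l < m - 2)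
    (n' : ℕ) (hn' : n' = 2 ^ (m - 2) - 3 * 2 ^ ((m + l - 4) / 2)) :
    ∃ C : Submodule (ZMod 2) (Fin (2 ^ (m - 1) - 1 + n') → ZMod 2),
      Module.finrank (ZMod 2) C = m ∧
      wmin C = 2 ^ (m - 2) - 2 ^ ((m + l - 4) / 2) ∧
      wmax C = 2 ^ (m - 1) - 2 ^ ((m + l - 2) / 2) ∧
      IsMinimalCode C ∧
      2 * wmin C ≤ (2 - 1) * wmax C := by
  obtain ⟨q, k, rfl, rfl⟩ : ∃ q k, l = k + 1 ∧ m = 2 * (q + 2) + k + 1 := by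
    obtain ⟨c, rfl⟩ := hdvd
    rw [Nat.mul_div_cancel_left _ hl] at hodd
    obtain ⟨j, rfl⟩ := hodd
    have e : l * (2 * j + 1) = 2 * (l * j) + l := by ring
    exact ⟨l * j - 2, l - 1, by omega, by omega⟩
  rw [show 2 * (q + 2) + k + 1 - 1 = 2 * q + k + 4 by omega,
    show 2 * (q + 2) + k + 1 - 2 = 2 * q + k + 3 by omega,
    show (2 * (q + 2) + k + 1 + (k + 1) - 4) / 2 = q + k + 1 by omega] at *
  rw [show (2 * (q + 2) + k + 1 + (k + 1) - 2) / 2 = q + k + 2 by omega]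
  set h : ((Fin (q + 2) → ZMod 2) × (Fin (q + 2) → ZMod 2) × ZMod 2 × (Fin k → ZMod 2)) →ₗ[ZMod 2]
    ZMod 2 := LinearMap.proj 0 ∘ₗ LinearMap.fst _ _ _ with hh
  -- `T` is the modulus of the nonzero character sums
  obtain ⟨T, hT⟩ : ∃ T, T = 2 ^ (q + k) := ⟨_, rfl⟩
  have hT0 : 0 < T := by rw [hT]; positivity
  obtain ⟨M, hM⟩ : ∃ M, M = 2 ^ (2 * q + k) := ⟨_, rfl⟩
  have hTM : T ≤ M := by rw [hT, hM]; exact Nat.pow_le_pow_right (by norm_num) (by omega)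
  rw [pow_add _ (2 * q + k) 3, pow_add _ (q + k) 1, ← hT, ← hM] at hn'
  rw [pow_add _ (2 * q + k) 3, pow_add _ (q + k) 1, pow_add _ (q + k) 2, pow_add _ (2 * q + k) 4, ← hT, ← hM]
  have hwt : ∀ p, 2 * (hammingNorm (bentFamily (q + 2) k p) : ℤ) =
      16 * M - ∑ x, binarySign (bentFamily (q + 2) k p x) := fun p => by
    rw [two_mul_hammingNorm_bentFamily, hM]
    push_cast
    ring
  have hbound : ∀ p, p ≠ 0 → 8 * M ≤ hammingNorm (bentFamily (q + 2) k p) + 2 * T ∧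
      hammingNorm (bentFamily (q + 2) k p) ≤ 8 * M + 2 * T := fun p hp => by
    have h1 := abs_le.mp (abs_sum_binarySign_bentFamily_le hp)
    rw [show (2 : ℤ) ^ (q + 2 + k) = 4 * T by rw [hT]; push_cast; ring] at h1
    have := hwt p
    omega
  have hcard : Fintype.card (Fin (M * 2 ^ 4 - 1 + n')) = Fintype.card
      ({x : (Fin (q + 2) → ZMod 2) × (Fin (q + 2) → ZMod 2) × (Fin k → ZMod 2) // x ≠ 0} ⊕
        Fin n') := by
    rw [Fintype.card_sum, Fintype.card_subtype_compl]
    simp only [Fintype.card_prod, Fintype.card_fun, ZMod.card, Fintype.card_fin,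
      Fintype.card_subtype_eq, hM]
    congr 2
    ring
  set e := Fintype.equivOfCardEq hcard
  set Φ := LinearMap.funLeft (ZMod 2) (ZMod 2) e ∘ₗ extendedBentFamily (q + 2) k n' h with hΦ
  have hnorm : ∀ p, hammingNorm (Φ p) =
      hammingNorm (bentFamily (q + 2) k p) + if h p = 0 then 0 else n' := fun p => by
    rw [← hammingNorm_extendedBentFamily h p]
    exact hammingNorm_comp_equiv_s7 e (extendedBentFamily (q + 2) k n' h p)
  have hinj : Function.Injective Φ := by
    refine (injective_iff_map_eq_zero Φ).mpr fun p hp => by_contra fun hp0 => ?_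
    have h1 := hnorm p
    have h2 := (hbound p hp0).1
    rw [hp, hammingNorm_zero] at h1
    omega
  have hmin : wmin (LinearMap.range Φ) = 8 * M - 2 * T := by
    refine wmin_range Φ hinj (p := (0, 0, 1, 0)) (by simp) ?_ fun p hp => ?_
    · have h1 := hwt (0, 0, 1, 0)
      rw [sum_binarySign_bentFamily_one] at h1
      rw [hnorm]
      have h2 : (2 : ℤ) ^ (q + 2) * 2 ^ k = 4 * T := by rw [hT]; push_cast; ring
      simp [hh, binarySign, h2] at h1 ⊢
      omega
    · have := hbound p hp
      have := hnorm p
      omega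
  have hmax : wmax (LinearMap.range Φ) = 16 * M - 4 * T := by
    refine wmax_range Φ (p := (Pi.single 0 1, Pi.single 0 1, 1, 0)) ?_ fun p => ?_
    · have h1 := hwt (Pi.single 0 1, Pi.single 0 1, 1, 0)
      rw [sum_binarySign_bentFamily_one] at h1
      rw [hnorm]
      have h2 : (2 : ℤ) ^ (q + 2) * 2 ^ k = 4 * T := by rw [hT]; push_cast; ring
      simp [hh, binarySign, h2] at h1 ⊢
      omega
    · rcases eq_or_ne p 0 with rfl | hp
      · simp
      · have := hbound p hp
        rw [hnorm]
        split_ifs <;> omega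
  refine ⟨LinearMap.range Φ, ?_, by omega, by omega, ?_, by omega⟩
  · rw [LinearMap.finrank_range_of_inj hinj]
    simp
    ring
  · rintro _ ⟨p, rfl⟩ hp _ ⟨p', rfl⟩ hsub
    have hp0 : p ≠ 0 := (map_ne_zero_iff Φ hinj).mp hp
    rcases eq_or_ne p' 0 with rfl | hp'
    · exact ⟨0, by simp⟩
    rcases eq_or_ne p' p with rfl | hne
    · exact ⟨1, by simp⟩
    exfalso
    have hadd := hammingNorm_eq_add_sub (f := bentFamily (q + 2) k p)
      (g := bentFamily (q + 2) k p') fun x hx => by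
        have hx0 : x ≠ 0 := by
          rintro rfl
          exact hx (bentFamily_zero_right p')
        have hval : ∀ s, Φ s (e.symm (Sum.inl ⟨x, hx0⟩)) = bentFamily (q + 2) k s x := fun s => by
          simp [hΦ, LinearMap.funLeft_apply, extendedBentFamily]
        rw [← hval] at hx ⊢
        exact hsub hx
    rw [← map_sub] at hadd
    have := hbound p hp0
    have := hbound p' hp'
    have := hbound (p - p') (sub_ne_zero.mpr hne.symm)
    omega
end

section
/- Let m ≥ 5 be an odd integer and h ≥ 1 an integer, and set n' = 2^{m+h−2} − 2^{m−2} − 2^{(m−1)/2}. Then there exists a binary linear code (q = 2) with parameters [2^{m+h−1} − 2^{m−2} − 1 + n', m+h−1, 2^{m+h−2} − 2^{m−3} − 2^{(m−3)/2}]_2 whose maximum weight is at least 2^{m+h−1} − 2^{m−2} − 2^{(m−1)/2}, and which is a minimal code violating the Ashikhmin-Barg condition. -/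
open Finset BigOperators

/-- The nontrivial character of `ZMod 2`, with integer values. -/
def signChar (a : ZMod 2) : ℤ := if a = 0 then 1 else -1

lemma signChar_add (a b : ZMod 2) : signChar (a + b) = signChar a * signChar b := by
  revert a b; decide

lemma abs_signChar (a : ZMod 2) : |signChar a| = 1 := by
  revert a; decide

lemma eq_one_of_ne_zero_zmod_two (a : ZMod 2) : a ≠ 0 → a = 1 := by
  revert a; decide

lemma sum_signChar_eq_card_sub {α : Type*} (s : Finset α) (f : α → ZMod 2) :
    ∑ a ∈ s, signChar (f a) = (#s : ℤ) - 2 * #{a ∈ s | f a ≠ 0} := by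
  rw [Finset.card_eq_sum_ones, Finset.card_filter]
  push_cast
  rw [Finset.mul_sum, ← Finset.sum_sub_distrib]
  refine Finset.sum_congr rfl fun a _ => ?_
  by_cases h : f a = 0 <;> simp [signChar, h]

lemma sum_signChar_linearMap {V : Type*} [AddCommGroup V] [Module (ZMod 2) V] [Fintype V]
    (u : V →ₗ[ZMod 2] ZMod 2) [Decidable (u = 0)] :
    ∑ v, signChar (u v) = if u = 0 then (Fintype.card V : ℤ) else 0 := by
  split_ifs with h
  · simp [h, signChar]
  · obtain ⟨w, hw⟩ : ∃ w, u w ≠ 0 := by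
      by_contra! hc
      exact h (LinearMap.ext hc)
    have key : ∑ v, signChar (u v) = ∑ v, -signChar (u v) := by
      rw [← Equiv.sum_comp (Equiv.addRight w)]
      refine Finset.sum_congr rfl fun v _ => ?_
      have h1 : signChar (u w) = -1 := if_neg hw
      simp [signChar_add, h1]
    rw [Finset.sum_neg_distrib] at key
    linarith

section Code

variable {V : Type} [AddCommGroup V] [Module (ZMod 2) V] {N : ℕ}

/-- Evaluation of linear functionals at the points of the family `g`. -/
def evalMap (g : Fin N → V) : (V →ₗ[ZMod 2] ZMod 2) →ₗ[ZMod 2] (Fin N → ZMod 2) where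
  toFun u i := u (g i)
  map_add' _ _ := rfl
  map_smul' _ _ := rfl

lemma hammingNorm_evalMap (g : Fin N → V) (u : V →ₗ[ZMod 2] ZMod 2) :
    hammingNorm (evalMap g u) = #{i | u (g i) ≠ 0} := rfl

/-- Lengthening the complement of the point set `D` in the simplex code by `r` copies of the
coordinate `v₀`. -/
theorem exists_minimal_code_of_complement [Fintype V] [DecidableEq V]
    {q M r : ℕ} (hV : Fintype.card V = 2 * q) (D : Finset V) (hD : 0 ∉ D)
    (hM : ∀ u : V →ₗ[ZMod 2] ZMod 2, #{v ∈ D | u v ≠ 0} ≤ M) (hq : 2 * M < q) (v₀ : V)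
    {u₀ u₁ : V →ₗ[ZMod 2] ZMod 2} (hu₀ : #{v ∈ D | u₀ v ≠ 0} = 0) (hu₀v : u₀ v₀ ≠ 0)
    (hu₁ : #{v ∈ D | u₁ v ≠ 0} = M) (hu₁v : u₁ v₀ = 0) (hu₁0 : u₁ ≠ 0)
    (hN : N = 2 * q - #D - 1 + r) :
    ∃ C : Submodule (ZMod 2) (Fin N → ZMod 2),
      Module.finrank (ZMod 2) C = Module.finrank (ZMod 2) V ∧ wmin C = q - M ∧
      q + r ≤ wmax C ∧ IsMinimalCode C := by
  classical
  set E : Finset V := (insert 0 D)ᶜ with hE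
  have hcard : Fintype.card (E ⊕ Fin r) = Fintype.card (Fin N) := by
    rw [Fintype.card_sum, Fintype.card_coe, Fintype.card_fin, Fintype.card_fin, hE,
      Finset.card_compl, Finset.card_insert_of_notMem hD, hV]
    omega
  let e : (E ⊕ Fin r) ≃ Fin N := Fintype.equivOfCardEq hcard
  let g : Fin N → V := fun i => Sum.elim (fun v : E => (v : V)) (fun _ => v₀) (e.symm i)
  have hge : ∀ j, g (e j) = Sum.elim (fun v : E => (v : V)) (fun _ => v₀) j := fun j => by
    simp [g]
  have hwt : ∀ u : V →ₗ[ZMod 2] ZMod 2, hammingNorm (evalMap g u) =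
      #{v ∈ E | u v ≠ 0} + if u v₀ ≠ 0 then r else 0 := by
    intro u
    rw [hammingNorm_evalMap, Finset.card_filter, ← Equiv.sum_comp e, Fintype.sum_sum_type,
      Finset.card_filter, ← Finset.sum_coe_sort E]
    simp [hge]
  have hbase : ∀ u : V →ₗ[ZMod 2] ZMod 2, u ≠ 0 →
      #{v ∈ E | u v ≠ 0} + #{v ∈ D | u v ≠ 0} = q := by
    intro u hu
    have h1 := sum_signChar_eq_card_sub Finset.univ u
    rw [sum_signChar_linearMap, if_neg hu, Finset.card_univ, hV] at h1
    have h2 : #{v ∈ E | u v ≠ 0} + #{v ∈ D | u v ≠ 0} = #{v | u v ≠ 0} := by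
      rw [← Finset.card_union_of_disjoint]
      · congr 1
        ext v
        have : v = 0 → u v = 0 := fun h => by rw [h, map_zero]
        simp only [hE, Finset.mem_union, Finset.mem_filter, Finset.mem_compl, Finset.mem_insert,
          Finset.mem_univ]
        tauto
      · rw [Finset.disjoint_left]
        intro v
        simp only [hE, Finset.mem_filter, Finset.mem_compl, Finset.mem_insert]
        tauto
    push_cast at h1
    omega
  have hlower : ∀ u : V →ₗ[ZMod 2] ZMod 2, u ≠ 0 → q - M ≤ #{v ∈ E | u v ≠ 0} := by
    intro u hu
    have := hbase u hu
    have := hM u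
    omega
  have hinj : Function.Injective (evalMap g) := by
    rw [injective_iff_map_eq_zero]
    intro u hu
    by_contra h0
    have h1 := hwt u
    have h2 := hlower u h0
    rw [hu, hammingNorm_zero] at h1
    omega
  refine ⟨LinearMap.range (evalMap g), ?_, ?_, ?_, ?_⟩
  · rw [LinearMap.finrank_range_of_inj hinj]
    exact Subspace.dual_finrank_eq
  · refine IsLeast.csInf_eq ⟨⟨evalMap g u₁, ⟨u₁, rfl⟩, ?_, ?_⟩, ?_⟩
    · exact fun h => hu₁0 (hinj (h.trans (map_zero _).symm))
    · have := hbase u₁ hu₁0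
      rw [hwt, if_neg (not_not.mpr hu₁v)]
      omega
    · rintro w ⟨_, ⟨u, rfl⟩, hu, rfl⟩
      have hu0 : u ≠ 0 := by
        rintro rfl
        exact hu (map_zero _)
      rw [hwt]
      exact (hlower u hu0).trans (Nat.le_add_right _ _)
  · refine le_csSup ⟨N, ?_⟩ ⟨evalMap g u₀, ⟨u₀, rfl⟩, ?_⟩
    · rintro w ⟨c, -, rfl⟩
      simpa using hammingNorm_le_card_fintype (x := c)
    · have hu₀0 : u₀ ≠ 0 := by
        rintro rfl
        exact hu₀v rfl
      have := hbase u₀ hu₀0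
      rw [hwt, if_pos hu₀v]
      omega
  · rintro _ ⟨u, rfl⟩ hu _ ⟨u', rfl⟩ hsub
    by_cases h' : u' = 0
    · exact ⟨0, by simp [h']⟩
    by_cases h : u' = u
    · exact ⟨1, by simp [h]⟩
    exfalso
    have hu0 : u ≠ 0 := by
      rintro rfl
      exact hu (map_zero _)
    have hsub' : ∀ v ∈ E, u' v ≠ 0 → u v ≠ 0 := by
      intro v hv hne
      have := @hsub (e (Sum.inl ⟨v, hv⟩))
      simp only [evalMap, LinearMap.coe_mk, AddHom.coe_mk, hge, Sum.elim_inl,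
        Set.mem_ofPred_eq] at this
      exact this hne
    have hsplit : #{v ∈ E | u' v ≠ 0} + #{v ∈ E | (u - u') v ≠ 0} = #{v ∈ E | u v ≠ 0} := by
      simp only [Finset.card_filter, ← Finset.sum_add_distrib, LinearMap.sub_apply]
      refine Finset.sum_congr rfl fun v hv => ?_
      have := hsub' v hv
      generalize u v = a at *
      generalize u' v = b at *
      revert a b
      decide
    have h1 := hlower u' h'
    have h2 := hlower (u - u') (sub_ne_zero.mpr (Ne.symm h))
    have h3 := hbase u hu0
    omega

end Code

section Quadric

variable (t h : ℕ)

/-- The ambient space of the point set `quadricPoints`. -/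
abbrev QuadricSpace : Type :=
  (Fin t → ZMod 2) × (Fin t → ZMod 2) × ZMod 2 × ZMod 2 × (Fin h → ZMod 2)

/-- The graph of the semibent function `(x, y, z) ↦ 1 + x ⬝ y`. -/
def graphPoint (p : (Fin t → ZMod 2) × (Fin t → ZMod 2) × ZMod 2) : QuadricSpace t h :=
  (p.1, p.2.1, p.2.2, 1 + p.1 ⬝ᵥ p.2.1, 0)

lemma graphPoint_injective : Function.Injective (graphPoint t h) := by
  rintro ⟨x, y, z⟩ ⟨x', y', z'⟩ hp
  simp only [graphPoint, Prod.mk.injEq] at hp ⊢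
  exact ⟨hp.1, hp.2.1, hp.2.2.1⟩

/-- The point set formed by the graph of a semibent function. -/
def quadricPoints : Finset (QuadricSpace t h) := Finset.univ.image (graphPoint t h)

lemma card_quadricPoints : #(quadricPoints t h) = 2 ^ (2 * t + 1) := by
  rw [quadricPoints, Finset.card_image_of_injective _ (graphPoint_injective t h)]
  simp [Fintype.card_prod, ZMod.card]
  ring

lemma zero_notMem_quadricPoints : (0 : QuadricSpace t h) ∉ quadricPoints t h := by
  simp only [quadricPoints, Finset.mem_image, not_exists, not_and]
  rintro ⟨x, y, z⟩ - hp
  simp only [graphPoint, Prod.ext_iff, Prod.fst_zero, Prod.snd_zero] at hp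
  obtain ⟨rfl, rfl, -, h4, -⟩ := hp
  simp at h4

variable {t h}

/-- The dot product with `x` as a linear functional. -/
def dotFunctional (x : Fin t → ZMod 2) : (Fin t → ZMod 2) →ₗ[ZMod 2] ZMod 2 :=
  dotProductBilin (ZMod 2) (ZMod 2) x

lemma dotFunctional_apply (x y : Fin t → ZMod 2) : dotFunctional x y = x ⬝ᵥ y := rfl

lemma dotFunctional_injective : Function.Injective (dotFunctional (t := t)) := by
  intro x x' hx
  refine dotProduct_eq _ _ fun y => ?_
  exact LinearMap.congr_fun hx y

lemma sum_signChar_dot (α β : (Fin t → ZMod 2) →ₗ[ZMod 2] ZMod 2) :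
    ∑ x, ∑ y, signChar (α x + β y + x ⬝ᵥ y) =
      ∑ x, if β + dotFunctional x = 0 then signChar (α x) * 2 ^ t else 0 := by
  refine Finset.sum_congr rfl fun x _ => ?_
  have := sum_signChar_linearMap (β + dotFunctional x)
  simp only [LinearMap.add_apply, dotFunctional_apply] at this
  simp only [add_assoc, signChar_add (α x), ← Finset.mul_sum, this]
  simp [ZMod.card]

lemma abs_sum_signChar_dot_le (α β : (Fin t → ZMod 2) →ₗ[ZMod 2] ZMod 2) :
    |∑ x, ∑ y, signChar (α x + β y + x ⬝ᵥ y)| ≤ 2 ^ t := by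
  rw [sum_signChar_dot]
  by_cases hx : ∃ x, β + dotFunctional x = 0
  · obtain ⟨x, hx⟩ := hx
    rw [Finset.sum_eq_single x]
    · rw [if_pos hx, abs_mul, abs_signChar, one_mul, abs_of_nonneg (by positivity)]
    · intro b _ hb
      rw [if_neg]
      intro hb'
      exact hb (dotFunctional_injective (add_left_cancel (hb'.trans hx.symm)))
    · simp
  · push Not at hx
    simp [hx]

lemma sum_signChar_dot_zero :
    ∑ x : Fin t → ZMod 2, ∑ y, signChar (x ⬝ᵥ y) = 2 ^ t := by
  have := sum_signChar_dot (t := t) 0 0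
  simp only [LinearMap.zero_apply, zero_add] at this
  rw [this, Finset.sum_eq_single 0]
  · rw [if_pos]
    · simp [signChar]
    · ext y
      simp [dotFunctional_apply]
  · intro b _ hb
    rw [if_neg]
    intro hb'
    refine hb (dotFunctional_injective (hb'.trans ?_))
    ext y
    simp [dotFunctional_apply]
  · simp

lemma sum_quadricPoints (u : QuadricSpace t h →ₗ[ZMod 2] ZMod 2) :
    ∑ v ∈ quadricPoints t h, signChar (u v) = ∑ p, signChar (u (graphPoint t h p)) := by
  rw [quadricPoints, Finset.sum_image fun _ _ _ _ hp => graphPoint_injective t h hp]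

lemma two_mul_card_quadricPoints_filter (u : QuadricSpace t h →ₗ[ZMod 2] ZMod 2) :
    2 * (#{v ∈ quadricPoints t h | u v ≠ 0} : ℤ) =
      2 ^ (2 * t + 1) - ∑ p, signChar (u (graphPoint t h p)) := by
  rw [← sum_quadricPoints, sum_signChar_eq_card_sub, card_quadricPoints]
  push_cast
  ring

lemma neg_le_sum_graphPoint (u : QuadricSpace t h →ₗ[ZMod 2] ZMod 2) :
    -2 ^ (t + 1) ≤ ∑ p, signChar (u (graphPoint t h p)) := by
  let α : (Fin t → ZMod 2) →ₗ[ZMod 2] ZMod 2 := u ∘ₗ LinearMap.inl _ _ _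
  let β : (Fin t → ZMod 2) →ₗ[ZMod 2] ZMod 2 :=
    u ∘ₗ LinearMap.inr _ _ _ ∘ₗ LinearMap.inl _ _ _
  let γ : ZMod 2 →ₗ[ZMod 2] ZMod 2 :=
    u ∘ₗ LinearMap.inr _ _ _ ∘ₗ LinearMap.inr _ _ _ ∘ₗ LinearMap.inl _ _ _
  let d : ZMod 2 := u (0, 0, 0, 1, 0)
  have hu : ∀ p, u (graphPoint t h p) =
      α p.1 + β p.2.1 + γ p.2.2 + (1 + p.1 ⬝ᵥ p.2.1) * d := by
    rintro ⟨x, y, z⟩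
    simp only [α, β, γ, d, LinearMap.comp_apply, LinearMap.inl_apply, LinearMap.inr_apply,
      ← map_add, ← smul_eq_mul, ← map_smul]
    simp [graphPoint]
  by_cases hd : d = 0
  · have hlin : ∀ p : (Fin t → ZMod 2) × (Fin t → ZMod 2) × ZMod 2,
        u (graphPoint t h p) = (α.coprod (β.coprod γ)) p := by
      intro p
      rw [hu, hd]
      simp [add_assoc]
    simp only [hlin, sum_signChar_linearMap]
    refine le_trans (neg_nonpos.mpr (by positivity)) ?_
    split_ifs <;> positivity
  · replace hd := eq_one_of_ne_zero_zmod_two d hd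
    have hfactor : ∑ p, signChar (u (graphPoint t h p)) =
        -((∑ z, signChar (γ z)) * ∑ x, ∑ y, signChar (α x + β y + x ⬝ᵥ y)) := by
      simp only [Fintype.sum_prod_type, Finset.mul_sum, Finset.sum_mul, ← Finset.sum_neg_distrib]
      refine Finset.sum_congr rfl fun x _ => Finset.sum_congr rfl fun y _ =>
        Finset.sum_congr rfl fun z _ => ?_
      have h1 : signChar 1 = -1 := by decide
      rw [hu, hd]
      simp only [signChar_add, mul_one, h1]
      ring
    rw [hfactor, pow_succ', sum_signChar_linearMap]
    have hb := abs_le.mp (abs_sum_signChar_dot_le α β)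
    split_ifs
    · simp only [ZMod.card]
      push_cast
      linarith
    · simp

lemma card_quadricPoints_filter_le (u : QuadricSpace t h →ₗ[ZMod 2] ZMod 2) :
    #{v ∈ quadricPoints t h | u v ≠ 0} ≤ 2 ^ (2 * t) + 2 ^ t := by
  have h1 := two_mul_card_quadricPoints_filter u
  have h2 := neg_le_sum_graphPoint u
  rw [pow_succ] at h1 h2
  zify
  linarith

/-- The functional reading off the value of the semibent function. -/
def valueFunctional : QuadricSpace t h →ₗ[ZMod 2] ZMod 2 :=
  LinearMap.fst _ _ _ ∘ₗ LinearMap.snd _ _ _ ∘ₗ LinearMap.snd _ _ _ ∘ₗ LinearMap.snd _ _ _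

/-- The functional reading off one of the coordinates that vanish on `quadricPoints`. -/
def extraFunctional (i : Fin h) : QuadricSpace t h →ₗ[ZMod 2] ZMod 2 :=
  LinearMap.proj i ∘ₗ LinearMap.snd _ _ _ ∘ₗ LinearMap.snd _ _ _ ∘ₗ LinearMap.snd _ _ _ ∘ₗ
    LinearMap.snd _ _ _

lemma card_filter_valueFunctional :
    #{v ∈ quadricPoints t h | valueFunctional v ≠ 0} = 2 ^ (2 * t) + 2 ^ t := by
  have h1 := two_mul_card_quadricPoints_filter (valueFunctional (t := t) (h := h))
  have h2 : ∑ p, signChar (valueFunctional (graphPoint t h p)) = -2 ^ (t + 1) := by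
    have h3 : ∀ x y : Fin t → ZMod 2, ∑ z : ZMod 2,
        signChar (valueFunctional (graphPoint t h (x, y, z))) = -2 * signChar (x ⬝ᵥ y) := by
      intro x y
      have h4 : signChar 1 = -1 := by decide
      simp [valueFunctional, graphPoint, signChar_add, h4, ZMod.card]
    simp only [Fintype.sum_prod_type, h3, ← Finset.mul_sum, sum_signChar_dot_zero]
    ring
  rw [h2, pow_succ, pow_succ] at h1
  zify
  linarith

lemma card_filter_extraFunctional (i : Fin h) :
    #{v ∈ quadricPoints t h | extraFunctional i v ≠ 0} = 0 := by
  rw [Finset.card_eq_zero, Finset.filter_eq_empty_iff]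
  intro v hv
  obtain ⟨p, -, rfl⟩ := Finset.mem_image.mp hv
  simp [extraFunctional, graphPoint]

end Quadric

/-- Proposition 4.5. -/
theorem minimal_code_violating_AB_from_complementary_three_weight
    {m h : ℕ} (hm : 5 ≤ m) (hodd : Odd m) (hh : 1 ≤ h)
    (n' : ℕ) (hn' : n' = 2 ^ (m + h - 2) - 2 ^ (m - 2) - 2 ^ ((m - 1) / 2)) :
    ∃ C : Submodule (ZMod 2) (Fin (2 ^ (m + h - 1) - 2 ^ (m - 2) - 1 + n') → ZMod 2),
      Module.finrank (ZMod 2) C = m + h - 1 ∧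
      wmin C = 2 ^ (m + h - 2) - 2 ^ (m - 3) - 2 ^ ((m - 3) / 2) ∧
      wmax C ≥ 2 ^ (m + h - 1) - 2 ^ (m - 2) - 2 ^ ((m - 1) / 2) ∧
      IsMinimalCode C ∧
      2 * wmin C ≤ (2 - 1) * wmax C := by
  obtain ⟨s, rfl⟩ := hodd
  obtain ⟨t, rfl⟩ : ∃ t, s = t + 1 := ⟨s - 1, by omega⟩
  rw [show 2 * (t + 1) + 1 + h - 2 = 2 * t + 1 + h by omega,
    show 2 * (t + 1) + 1 - 2 = 2 * t + 1 by omega,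
    show (2 * (t + 1) + 1 - 1) / 2 = t + 1 by omega] at *
  rw [show 2 * (t + 1) + 1 + h - 1 = 2 * t + 1 + h + 1 by omega,
    show 2 * (t + 1) + 1 - 3 = 2 * t by omega, show 2 * t / 2 = t by omega]
  have hpow : 2 ^ (t + 1) < 2 ^ (2 * t + 1) := Nat.pow_lt_pow_right one_lt_two (by omega)
  have hpow' : 2 ^ (2 * t + 1 + 1) ≤ 2 ^ (2 * t + 1 + h) :=
    Nat.pow_le_pow_right two_pos (by omega)
  have hV : Fintype.card (QuadricSpace t h) = 2 * 2 ^ (2 * t + 1 + h) := by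
    simp [Fintype.card_prod, ZMod.card]
    ring
  have e1 := pow_succ 2 t
  have e2 := pow_succ 2 (2 * t)
  have e3 := pow_succ 2 (2 * t + 1)
  have e4 := pow_succ 2 (2 * t + 1 + h)
  obtain ⟨C, hrank, hmin, hmax, hminimal⟩ := exists_minimal_code_of_complement
    (N := 2 ^ (2 * t + 1 + h + 1) - 2 ^ (2 * t + 1) - 1 + n') (r := n')
    hV (quadricPoints t h) (zero_notMem_quadricPoints t h) card_quadricPoints_filter_le
    (by omega) (0, 0, 0, 0, 1) (card_filter_extraFunctional ⟨0, hh⟩)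
    (by simp [extraFunctional]) card_filter_valueFunctional (by simp [valueFunctional])
    (fun h0 => by
      have := LinearMap.congr_fun h0 (0, 0, 0, 1, 0)
      simp [valueFunctional] at this)
    (by rw [card_quadricPoints, pow_succ' 2 (2 * t + 1 + h)])
  refine ⟨C, ?_, ?_, ?_, hminimal, ?_⟩
  · rw [hrank]
    simp
    ring
  all_goals omega
end
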